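/- arXiv:math-ph/0505058 — 6 statements merged into one kernel-verified Lean document; each statement's English description precedes it below -/
import Mathlib

section
/- Let N ≥ 1, let f : ℝ^N → ℝ be C^∞, let a < b be reals such that K = f⁻¹([a,b]) is compact and there exists C > 0 with ‖∇f(x)‖ ≥ C for all x ∈ K. Then there exists a continuous map σ : [0, b−a] × f⁻¹({a}) → ℝ^N such that: (i) σ(0,x) = x for every x ∈ f⁻¹({a}); (ii) for every x ∈ f⁻¹({a}) and t ∈ [0, b−a], the curve t ↦ σ(t,x) is differentiable with derivative ∇f(σ(t,x))/‖∇f(σ(t,x))‖²; (iii) f(σ(t,x)) = a + t for all t, x; (iv) for every t ∈ [0, b−a] the map x ↦ σ(t,x) is a bijection from f⁻¹({a}) onto f⁻¹({a+t}). -/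
open Set

section FlowHelpers

variable {E : Type*} [NormedAddCommGroup E] [NormedSpace ℝ E]

/-- Existence on `[0, T]` for bounded globally Lipschitz fields, any initial time. -/
lemma flowAux_exists [CompleteSpace E] {v : E → E} {K L : NNReal} (hl : LipschitzWith K v)
    (hb : ∀ x, ‖v x‖ ≤ L) {T t₀ : ℝ} (ht₀ : t₀ ∈ Icc 0 T) (x : E) :
    ∃ γ : ℝ → E, γ t₀ = x ∧ ∀ t ∈ Icc 0 T, HasDerivWithinAt γ (v (γ t)) (Icc 0 T) t := by
  have hT : 0 ≤ T := ht₀.1.trans ht₀.2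
  have h : IsPicardLindelof (fun _ => v) (⟨t₀, ht₀⟩ : Icc 0 T) x (L * T.toNNReal) 0 L K := by
    apply IsPicardLindelof.of_time_independent
    · intro y _; exact hb y
    · exact hl.lipschitzOnWith
    · have : max (T - t₀) (t₀ - 0) ≤ T := max_le (by linarith [ht₀.1]) (by linarith [ht₀.2])
      simpa [hT] using mul_le_mul_of_nonneg_left this L.2
  exact h.exists_eq_forall_mem_Icc_hasDerivWithinAt₀

lemma flowAux_Ici {g : ℝ → E} {g' : E} {T t : ℝ} (ht : t ∈ Ico 0 T)
    (h : HasDerivWithinAt g g' (Icc 0 T) t) : HasDerivWithinAt g g' (Ici t) t := by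
  refine h.mono_of_mem_nhdsWithin ?_
  exact Filter.mem_of_superset (Icc_mem_nhdsGE ht.2) (Icc_subset_Icc_left ht.1)

lemma flowAux_Iic {g : ℝ → E} {g' : E} {T t : ℝ} (ht : t ∈ Ioc 0 T)
    (h : HasDerivWithinAt g g' (Icc 0 T) t) : HasDerivWithinAt g g' (Iic t) t := by
  refine h.mono_of_mem_nhdsWithin ?_
  exact Filter.mem_of_superset (Icc_mem_nhdsLE ht.1) (Icc_subset_Icc_right ht.2)

lemma flowAux_dist {v : E → E} {K : NNReal} (hl : LipschitzWith K v) {T : ℝ} {γ η : ℝ → E}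
    (hγ : ∀ t ∈ Icc 0 T, HasDerivWithinAt γ (v (γ t)) (Icc 0 T) t)
    (hη : ∀ t ∈ Icc 0 T, HasDerivWithinAt η (v (η t)) (Icc 0 T) t) {t : ℝ} (ht : t ∈ Icc 0 T) :
    dist (γ t) (η t) ≤ dist (γ 0) (η 0) * Real.exp (K * T) := by
  have h := dist_le_of_trajectories_ODE (v := fun _ => v) (fun _ => hl)
    (fun t ht => (hγ t ht).continuousWithinAt)
    (fun t ht => flowAux_Ici ht (hγ t (Ico_subset_Icc_self ht)))
    (fun t ht => (hη t ht).continuousWithinAt)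
    (fun t ht => flowAux_Ici ht (hη t (Ico_subset_Icc_self ht))) le_rfl t ht
  refine h.trans ?_
  have := ht.2
  gcongr
  linarith

lemma flowAux_back {v : E → E} {K : NNReal} (hl : LipschitzWith K v) {T : ℝ} {γ η : ℝ → E}
    (hγ : ∀ t ∈ Icc 0 T, HasDerivWithinAt γ (v (γ t)) (Icc 0 T) t)
    (hη : ∀ t ∈ Icc 0 T, HasDerivWithinAt η (v (η t)) (Icc 0 T) t) {t : ℝ} (ht : t ∈ Icc 0 T)
    (h : γ t = η t) : γ 0 = η 0 := by
  have hs : Icc 0 t ⊆ Icc 0 T := Icc_subset_Icc_right ht.2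
  have hs' : Ioc 0 t ⊆ Ioc 0 T := Ioc_subset_Ioc_right ht.2
  exact ODE_solution_unique_of_mem_Icc_left (v := fun _ => v) (s := fun _ => univ)
    (fun _ _ => hl.lipschitzOnWith)
    (fun t ht => (hγ t (hs ht)).continuousWithinAt.mono hs)
    (fun t ht => flowAux_Iic (hs' ht) (hγ t (Ioc_subset_Icc_self (hs' ht)))) (fun _ _ => trivial)
    (fun t ht => (hη t (hs ht)).continuousWithinAt.mono hs)
    (fun t ht => flowAux_Iic (hs' ht) (hη t (Ioc_subset_Icc_self (hs' ht)))) (fun _ _ => trivial)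
    h ⟨le_rfl, ht.1⟩

lemma flowAux_mono {g g' : ℝ → ℝ} {T : ℝ}
    (h : ∀ t ∈ Icc 0 T, HasDerivWithinAt g (g' t) (Icc 0 T) t)
    (h0 : ∀ t ∈ Icc 0 T, 0 ≤ g' t) : MonotoneOn g (Icc 0 T) :=
  monotoneOn_of_hasDerivWithinAt_nonneg (convex_Icc 0 T)
    (fun t ht => (h t ht).continuousWithinAt)
    (fun t ht => (h t (interior_subset ht)).mono interior_subset)
    (fun t ht => h0 t (interior_subset ht))

/-- If `g' = χ t ∈ [0,1]`, with `χ t = 1` when `g t ∈ [a,b]`, and `g t₀ = a + t₀`,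
then `g t = a + t` throughout. -/
lemma flowAux_level {g c : ℝ → ℝ} {a b : ℝ}
    (h : ∀ t ∈ Icc 0 (b - a), HasDerivWithinAt g (c t) (Icc 0 (b - a)) t)
    (hc : ∀ t, c t ∈ Icc (0 : ℝ) 1) (h1 : ∀ t, g t ∈ Icc a b → c t = 1)
    {t₀ : ℝ} (ht₀ : t₀ ∈ Icc 0 (b - a)) (hg : g t₀ = a + t₀) :
    ∀ t ∈ Icc 0 (b - a), g t = a + t := by
  have m1 := flowAux_mono h (fun t _ => (hc t).1)
  have m2 : MonotoneOn (fun t => t - g t) (Icc 0 (b - a)) :=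
    flowAux_mono (fun t ht => (hasDerivWithinAt_id t _).sub (h t ht))
      (fun t _ => by linarith [(hc t).2])
  have hmem : ∀ t ∈ Icc 0 (b - a), g t ∈ Icc a b := by
    intro t ht
    rcases le_total t t₀ with hle | hle
    · have e1 := m1 ht ht₀ hle
      have e2 := m2 ht ht₀ hle
      simp only at e2
      constructor <;> linarith [ht.1, ht₀.2]
    · have e1 := m1 ht₀ ht hle
      have e2 := m2 ht₀ ht hle
      simp only at e2
      constructor <;> linarith [ht.2, ht₀.1]
  have m3 : MonotoneOn (fun t => g t - t) (Icc 0 (b - a)) :=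
    flowAux_mono (fun t ht => (h t ht).sub (hasDerivWithinAt_id t _))
      (fun t ht => by rw [h1 t (hmem t ht)]; norm_num)
  intro t ht
  rcases le_total t t₀ with hle | hle
  · have e1 := m3 ht ht₀ hle
    have e2 := m2 ht ht₀ hle
    simp only at e1 e2
    linarith
  · have e1 := m3 ht₀ ht hle
    have e2 := m2 ht₀ ht hle
    simp only at e1 e2
    linarith

end FlowHelpers

open scoped Manifold in
lemma flowAux_field {N : ℕ} (f : EuclideanSpace ℝ (Fin N) → ℝ)
    (hf : ContDiff ℝ (⊤ : ℕ∞) f) (K : Set (EuclideanSpace ℝ (Fin N)))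
    (hK : IsCompact K) (hgrad : ∀ x ∈ K, gradient f x ≠ 0) :
    ∃ χ : EuclideanSpace ℝ (Fin N) → ℝ, (∀ x, χ x ∈ Icc (0 : ℝ) 1) ∧ (∀ x ∈ K, χ x = 1) ∧
      (∀ x, gradient f x = 0 → χ x = 0) ∧
      ∃ k L : NNReal,
        LipschitzWith k (fun x => χ x • ((‖gradient f x‖ ^ 2)⁻¹ • gradient f x)) ∧
        ∀ x, ‖χ x • ((‖gradient f x‖ ^ 2)⁻¹ • gradient f x)‖ ≤ L := by
  have hG : ContDiff ℝ 1 (gradient f) := by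
    have h1 : ContDiff ℝ 1 (fderiv ℝ f) := hf.fderiv_right (by norm_cast)
    exact (InnerProductSpace.toDual ℝ (EuclideanSpace ℝ (Fin N))).symm.contDiff.comp h1
  have hU : IsOpen {x | gradient f x ≠ 0} := isOpen_ne_fun hG.continuous continuous_const
  obtain ⟨M, hM, hKM, hMU⟩ := exists_compact_between hK hU hgrad
  obtain ⟨χ, h0, h1, hχ⟩ := exists_contMDiffMap_zero_one_of_isClosed
    (n := (⊤ : ℕ∞)) 𝓘(ℝ, EuclideanSpace ℝ (Fin N))
    (s := (interior M)ᶜ) (t := K) isOpen_interior.isClosed_compl hK.isClosed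
    (disjoint_left.2 fun x hx hx' => hx (hKM hx'))
  have hχd : ContDiff ℝ 1 χ := (χ.contMDiff.contDiff).of_le (by norm_cast)
  have hsub : tsupport χ ⊆ M := by
    refine closure_minimal (fun x hx => ?_) hM.isClosed
    by_contra hxM
    exact hx (h0 (fun h => hxM (interior_subset h)))
  have hcs : HasCompactSupport χ := hM.of_isClosed_subset (isClosed_tsupport _) hsub
  have hv : ContDiff ℝ 1 (fun x => χ x • ((‖gradient f x‖ ^ 2)⁻¹ • gradient f x)) := by
    rw [contDiff_iff_contDiffAt]
    intro x
    by_cases hx : x ∈ tsupport χ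
    swap
    · rw [notMem_tsupport_iff_eventuallyEq] at hx
      refine (contDiffAt_const (c := 0)).congr_of_eventuallyEq ?_
      filter_upwards [hx] with y hy
      simp [hy]
    have hx' : gradient f x ≠ 0 := hMU (hsub hx)
    have hsq : ContDiffAt ℝ 1 (fun y => ‖gradient f y‖ ^ 2) x := (hG.norm_sq ℝ).contDiffAt
    have hinv : ContDiffAt ℝ 1 (fun y => (‖gradient f y‖ ^ 2)⁻¹) x :=
      hsq.inv (pow_ne_zero 2 (norm_ne_zero_iff.2 hx'))
    exact hχd.contDiffAt.smul (hinv.smul hG.contDiffAt)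
  have hvc : HasCompactSupport (fun x => χ x • ((‖gradient f x‖ ^ 2)⁻¹ • gradient f x)) :=
    hcs.smul_right
  obtain ⟨k, hk⟩ := ContDiff.lipschitzWith_of_hasCompactSupport hvc hv one_ne_zero
  obtain ⟨L, hL⟩ := hvc.exists_bound_of_continuous hv.continuous
  refine ⟨χ, hχ, fun x hx => h1 hx, fun x hx => h0 fun h => hMU (interior_subset h) hx,
    k, L.toNNReal, hk, fun x => (hL x).trans (Real.le_coe_toNNReal L)⟩

/-- The flow of the vector field `X = ∇f / ‖∇f‖²` trivializes a smooth function `f`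
over an interval `[a, b]` free of critical points. -/
theorem flow_trivialization
    (N : ℕ) (hN : 1 ≤ N) (f : EuclideanSpace ℝ (Fin N) → ℝ)
    (hf : ContDiff ℝ (⊤ : ℕ∞) f) (a b : ℝ) (hab : a < b)
    (hK : IsCompact (f ⁻¹' Set.Icc a b))
    (C : ℝ) (hC : 0 < C)
    (hgrad : ∀ x ∈ f ⁻¹' Set.Icc a b, C ≤ ‖gradient f x‖) :
    ∃ σ : ℝ → EuclideanSpace ℝ (Fin N) → EuclideanSpace ℝ (Fin N),
      ContinuousOn (fun p : ℝ × EuclideanSpace ℝ (Fin N) => σ p.1 p.2)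
        (Set.Icc 0 (b - a) ×ˢ (f ⁻¹' {a})) ∧
      (∀ x ∈ f ⁻¹' {a}, σ 0 x = x) ∧
      (∀ x ∈ f ⁻¹' {a}, ∀ t ∈ Set.Icc 0 (b - a),
        HasDerivWithinAt (fun s => σ s x)
          ((‖gradient f (σ t x)‖ ^ 2)⁻¹ • gradient f (σ t x))
          (Set.Icc 0 (b - a)) t) ∧
      (∀ x ∈ f ⁻¹' {a}, ∀ t ∈ Set.Icc 0 (b - a), f (σ t x) = a + t) ∧
      (∀ t ∈ Set.Icc 0 (b - a), Set.BijOn (σ t) (f ⁻¹' {a}) (f ⁻¹' {a + t})) := by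
  obtain ⟨χ, hχ, hχ1, hχ0, k, L, hl, hb⟩ := flowAux_field f hf _ hK
    (fun x hx h => by have := hgrad x hx; rw [h, norm_zero] at this; linarith)
  set v : EuclideanSpace ℝ (Fin N) → EuclideanSpace ℝ (Fin N) :=
    fun x => χ x • ((‖gradient f x‖ ^ 2)⁻¹ • gradient f x) with hv
  have hT : (0 : ℝ) ∈ Icc 0 (b - a) := ⟨le_rfl, by linarith⟩
  -- the level function along an integral curve
  have hlevel : ∀ γ : ℝ → EuclideanSpace ℝ (Fin N),
      (∀ t ∈ Icc 0 (b - a), HasDerivWithinAt γ (v (γ t)) (Icc 0 (b - a)) t) →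
      ∀ t₀ ∈ Icc 0 (b - a), f (γ t₀) = a + t₀ → ∀ t ∈ Icc 0 (b - a), f (γ t) = a + t := by
    intro γ hγ t₀ ht₀ h0
    refine flowAux_level (g := fun t => f (γ t)) (c := fun t => χ (γ t)) ?_
      (fun t => hχ _) (fun t ht => hχ1 _ ht) ht₀ h0
    intro t ht
    have hd : HasGradientAt f (gradient f (γ t)) (γ t) :=
      ((hf.differentiable (by simp)) (γ t)).hasGradientAt
    have h1 := hd.hasFDerivAt.comp_hasDerivWithinAt t (hγ t ht)
    convert! h1 using 1
    by_cases hz : gradient f (γ t) = 0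
    · simp [hv, hz, hχ0 _ hz]
    · have : ‖gradient f (γ t)‖ ≠ 0 := norm_ne_zero_iff.2 hz
      simp only [hv, InnerProductSpace.toDual_apply_apply, inner_smul_right,
        real_inner_self_eq_norm_sq]
      field_simp
  choose φ hφ0 hφ using fun x => flowAux_exists hl hb hT x
  have hφl : ∀ x ∈ f ⁻¹' {a}, ∀ t ∈ Icc 0 (b - a), f (φ x t) = a + t := by
    intro x hx
    refine hlevel (φ x) (hφ x) 0 hT ?_
    rw [hφ0, add_zero]; exact hx
  refine ⟨fun t x => φ x t, ?_, fun x _ => hφ0 x, ?_, hφl, ?_⟩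
  · refine continuousOn_prod_of_continuousOn_lipschitzOnWith' _
      (Real.exp (k * (b - a))).toNNReal ?_ ?_
    · intro t ht
      refine LipschitzOnWith.of_dist_le_mul fun x _ y _ => ?_
      have := flowAux_dist hl (hφ x) (hφ y) ht
      rw [hφ0, hφ0] at this
      rw [Real.coe_toNNReal _ (Real.exp_pos _).le, mul_comm]
      exact this
    · intro x _ t ht
      exact (hφ x t ht).continuousWithinAt
  · intro x hx t ht
    have h := hφ x t ht
    have h1 : χ (φ x t) = 1 := by
      apply hχ1
      rw [mem_preimage, hφl x hx t ht]
      constructor <;> linarith [ht.1, ht.2]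
    simpa only [hv, h1, one_smul] using h
  · intro t ht
    refine ⟨fun x hx => hφl x hx t ht, fun x _ y _ hxy => ?_, fun y hy => ?_⟩
    · have := flowAux_back hl (hφ x) (hφ y) ht hxy
      rwa [hφ0, hφ0] at this
    · obtain ⟨γ, hγt, hγ⟩ := flowAux_exists hl hb ht y
      have hγl := hlevel γ hγ t ht (by rw [hγt]; exact hy)
      refine ⟨γ 0, by simpa using hγl 0 hT, ?_⟩
      have := flowAux_dist hl (hφ (γ 0)) hγ ht
      rw [hφ0, dist_self, zero_mul] at this
      rw [← hγt]
      exact dist_le_zero.1 this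
end

section
/- Let N ≥ 1, let f : ℝ^N → ℝ be C^∞, let a < b be reals such that f⁻¹([a,b]) is compact and there exists C > 0 with ‖∇f(x)‖ ≥ C for all x ∈ f⁻¹([a,b]). Then for any y, y' ∈ [a,b] the level sets f⁻¹({y}) and f⁻¹({y'}) are diffeomorphic in the following sense: there exist open sets U ⊇ f⁻¹({y}) and U' ⊇ f⁻¹({y'}) in ℝ^N and maps Φ : U → ℝ^N and Ψ : U' → ℝ^N that are C^∞ on U and U' respectively, such that Φ maps f⁻¹({y}) onto f⁻¹({y'}), Ψ ∘ Φ is the identity on f⁻¹({y}), and Φ ∘ Ψ is the identity on f⁻¹({y'}). -/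
open Set

open Filter Topology in
/-- Inverse function theorem near a compact set on which the map is injective. -/
theorem exists_inverse_near_compact {X : Type*} [NormedAddCommGroup X] [NormedSpace ℝ X]
    [FiniteDimensional ℝ X] (g : X → X) (hg : ContDiff ℝ (⊤ : ℕ∞) g) (L : Set X)
    (hL : IsCompact L) (hinj : InjOn g L)
    (hd : ∀ p ∈ L, Function.Injective (fderiv ℝ g p)) :
    ∃ (W : Set X) (σ : X → X), IsOpen W ∧ L ⊆ W ∧ (∀ V ⊆ W, IsOpen V → IsOpen (g '' V)) ∧
      ContDiffOn ℝ (⊤ : ℕ∞) σ (g '' W) ∧ ∀ p ∈ W, σ (g p) = p := by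
  have : CompleteSpace X := FiniteDimensional.complete ℝ X
  have hn : ((⊤ : ℕ∞) : WithTop ℕ∞) ≠ 0 := by simp
  let D : Set X := (fderiv ℝ g) ⁻¹' (range ((↑) : (X ≃L[ℝ] X) → X →L[ℝ] X))
  have hDo : IsOpen D := ContinuousLinearEquiv.isOpen.preimage (hg.continuous_fderiv hn)
  have hLD : L ⊆ D := by
    intro p hp
    refine ⟨(LinearEquiv.ofInjectiveEndo (fderiv ℝ g p : X →ₗ[ℝ] X)
      (hd p hp)).toContinuousLinearEquiv, ?_⟩
    ext v
    rfl
  have hstrict : ∀ p ∈ D, ∃ e : X ≃L[ℝ] X, HasStrictFDerivAt g (e : X →L[ℝ] X) p := by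
    rintro p ⟨e, he⟩
    refine ⟨e, ?_⟩
    rw [he]
    exact hg.contDiffAt.hasStrictFDerivAt hn
  obtain ⟨t, ht, htinj⟩ := hinj.exists_mem_nhdsSet hL (fun x _ => hg.continuous.continuousAt) (by
    intro p hp
    obtain ⟨e, he⟩ := hstrict p (hLD hp)
    refine ⟨_, he.eventually_left_inverse, ?_⟩
    intro x hx y hy hxy
    have hx' : he.localInverse g e p (g x) = x := hx
    have hy' : he.localInverse g e p (g y) = y := hy
    rw [← hx', ← hy', hxy])
  obtain ⟨T, hTo, hLT, hTt⟩ := mem_nhdsSet_iff_exists.1 ht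
  have hWinj : InjOn g (T ∩ D) := htinj.mono (inter_subset_left.trans hTt)
  have hleft : ∀ p ∈ T ∩ D, Function.invFunOn g (T ∩ D) (g p) = p :=
    fun p hp => hWinj.leftInvOn_invFunOn hp
  have hWo : IsOpen (T ∩ D) := hTo.inter hDo
  refine ⟨T ∩ D, Function.invFunOn g (T ∩ D), hWo, subset_inter hLT hLD, ?_, ?_, hleft⟩
  · intro V hV hVo
    rw [isOpen_iff_mem_nhds]
    rintro _ ⟨p, hp, rfl⟩
    obtain ⟨e, he⟩ := hstrict p (hV hp).2
    rw [← he.map_nhds_eq_of_equiv]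
    exact image_mem_map (hVo.mem_nhds hp)
  · rintro _ ⟨p, hp, rfl⟩
    obtain ⟨e, he⟩ := hstrict p hp.2
    have h1 := he.localInverse_unique (g := Function.invFunOn g (T ∩ D))
      (by filter_upwards [hWo.mem_nhds hp] with x hx using hleft x hx)
    exact ((hg.contDiffAt.to_localInverse he.hasFDerivAt hn).congr_of_eventuallyEq
      h1).contDiffWithinAt

/-- The relation of having diffeomorphic neighbourhoods-restricted maps between sets. -/
def SetDiffeo {E : Type*} [NormedAddCommGroup E] [NormedSpace ℝ E] (A B : Set E) : Prop :=
  ∃ (U U' : Set E) (Φ Ψ : E → E),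
      IsOpen U ∧ IsOpen U' ∧ A ⊆ U ∧ B ⊆ U' ∧
      ContDiffOn ℝ (⊤ : ℕ∞) Φ U ∧ ContDiffOn ℝ (⊤ : ℕ∞) Ψ U' ∧
      Φ '' A = B ∧ (∀ x ∈ A, Ψ (Φ x) = x) ∧ (∀ x ∈ B, Φ (Ψ x) = x)

theorem SetDiffeo.refl {E : Type*} [NormedAddCommGroup E] [NormedSpace ℝ E] (A : Set E) :
    SetDiffeo A A :=
  ⟨univ, univ, id, id, isOpen_univ, isOpen_univ, subset_univ _, subset_univ _,
    contDiff_id.contDiffOn, contDiff_id.contDiffOn, image_id _, fun _ _ => rfl, fun _ _ => rfl⟩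

theorem SetDiffeo.trans {E : Type*} [NormedAddCommGroup E] [NormedSpace ℝ E] {A B C : Set E}
    (h1 : SetDiffeo A B) (h2 : SetDiffeo B C) : SetDiffeo A C := by
  obtain ⟨U, U', Φ, Ψ, hU, hU', hA, hB, hΦ, hΨ, him, hl, hr⟩ := h1
  obtain ⟨V, V', F, G, hV, hV', hA2, hB2, hF, hG, him2, hl2, hr2⟩ := h2
  have hΦm : ∀ x ∈ A, Φ x ∈ B := fun x hx => him ▸ mem_image_of_mem Φ hx
  have hGm : ∀ x ∈ C, G x ∈ B := by
    intro x hx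
    rw [← him2] at hx
    obtain ⟨z, hz, rfl⟩ := hx
    rwa [hl2 z hz]
  refine ⟨U ∩ Φ ⁻¹' V, V' ∩ G ⁻¹' U', F ∘ Φ, Ψ ∘ G, hΦ.continuousOn.isOpen_inter_preimage hU hV,
    hG.continuousOn.isOpen_inter_preimage hV' hU', fun x hx => ⟨hA hx, hA2 (hΦm x hx)⟩,
    fun x hx => ⟨hB2 hx, hB (hGm x hx)⟩,
    hF.comp (hΦ.mono inter_subset_left) (fun x hx => hx.2),
    hΨ.comp (hG.mono inter_subset_left) (fun x hx => hx.2), ?_, ?_, ?_⟩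
  · rw [image_comp, him, him2]
  · intro x hx
    simp only [Function.comp]
    rw [hl2 _ (hΦm x hx), hl x hx]
  · intro x hx
    simp only [Function.comp]
    rw [hr _ (hGm x hx), hr2 x hx]

/-- Level sets at uniformly small distance are diffeomorphic. -/
theorem exists_eps_setDiffeo {E : Type*} [NormedAddCommGroup E] [InnerProductSpace ℝ E]
    [FiniteDimensional ℝ E] [CompleteSpace E] (f : E → ℝ)
    (hf : ContDiff ℝ (⊤ : ℕ∞) f) (K : Set E)
    (hK : IsCompact K) (hgrad : ∀ x ∈ K, gradient f x ≠ 0) :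
    ∃ ε > 0, ∀ y y' : ℝ, f ⁻¹' {y} ⊆ K → f ⁻¹' {y'} ⊆ K → |y - y'| < ε →
      SetDiffeo (f ⁻¹' {y}) (f ⁻¹' {y'}) := by
  have hn : ((⊤ : ℕ∞) : WithTop ℕ∞) ≠ 0 := by simp
  have hG : ContDiff ℝ (⊤ : ℕ∞) (gradient f) := by
    have h1 : ContDiff ℝ (⊤ : ℕ∞) (fderiv ℝ f) := hf.fderiv_right (by simp)
    exact (InnerProductSpace.toDual ℝ E).symm.contDiff.comp h1
  let A : E × ℝ → E := fun p => p.1 + p.2 • gradient f p.1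
  have hA : ContDiff ℝ (⊤ : ℕ∞) A :=
    contDiff_fst.add (contDiff_snd.smul (hG.comp contDiff_fst))
  let Q : E × ℝ → E × ℝ := fun p => (A p, f p.1)
  let R : E × ℝ → E × ℝ := fun p => (p.1, f (A p))
  have hQ : ContDiff ℝ (⊤ : ℕ∞) Q := hA.prodMk (hf.comp contDiff_fst)
  have hR : ContDiff ℝ (⊤ : ℕ∞) R := contDiff_fst.prodMk (hf.comp hA)
  have hA0 : ∀ x, A (x, 0) = x := fun x => by simp [A]
  have hfd : ∀ x v, fderiv ℝ f x v = inner ℝ (gradient f x) v := by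
    intro x v
    simp [gradient]
  have hdA : ∀ x, HasFDerivAt A (ContinuousLinearMap.fst ℝ E ℝ +
      (ContinuousLinearMap.snd ℝ E ℝ).smulRight (gradient f x)) (x, (0 : ℝ)) := by
    intro x
    have h1 : HasFDerivAt (fun p : E × ℝ => gradient f p.1) _ (x, (0:ℝ)) :=
      ((hG.comp contDiff_fst).differentiable hn (x, (0:ℝ))).hasFDerivAt
    have h2 := (hasFDerivAt_fst (𝕜 := ℝ) (p := (x, (0:ℝ)))).add
      ((hasFDerivAt_snd (𝕜 := ℝ) (p := (x, (0:ℝ)))).smul h1)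
    refine h2.congr_fderiv ?_
    ext v <;> simp
  have hdf : ∀ x, HasFDerivAt f (fderiv ℝ f x) x := fun x => (hf.differentiable hn x).hasFDerivAt
  let L : Set (E × ℝ) := K ×ˢ {0}
  have hL : IsCompact L := hK.prod isCompact_singleton
  obtain ⟨W, σ, hWo, hLW, hWim, hσ, hσl⟩ := exists_inverse_near_compact Q hQ L hL (by
      rintro ⟨x, s⟩ ⟨hx, rfl⟩ ⟨x', s'⟩ ⟨hx', rfl⟩ h
      have := congrArg Prod.fst h
      simp only [Q, hA0] at this
      rw [this]) (by
      rintro ⟨x, s⟩ ⟨hx, rfl⟩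
      have h1 : HasFDerivAt Q _ (x, (0:ℝ)) :=
        (hdA x).prodMk ((hdf x).comp (x, (0:ℝ)) hasFDerivAt_fst)
      rw [h1.fderiv, injective_iff_map_eq_zero]
      rintro ⟨v, s⟩ hv
      simp only [ContinuousLinearMap.prod_apply, Prod.mk_eq_zero] at hv
      obtain ⟨hv1, hv2⟩ := hv
      have hv1 : v + s • gradient f x = 0 := hv1
      have hv2 : fderiv ℝ f x v = 0 := hv2
      rw [hfd] at hv2
      have hv3 : v = -(s • gradient f x) := eq_neg_of_add_eq_zero_left hv1
      rw [hv3] at hv2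
      rw [inner_neg_right, inner_smul_right, neg_eq_zero, mul_eq_zero,
        inner_self_eq_zero] at hv2
      have hs : s = 0 := hv2.resolve_right (hgrad x hx)
      simp [hv3, hs])
  obtain ⟨W', τ, hWo', hLW', hWim', hτ, hτl⟩ := exists_inverse_near_compact R hR L hL (by
      rintro ⟨x, s⟩ ⟨hx, rfl⟩ ⟨x', s'⟩ ⟨hx', rfl⟩ h
      have := congrArg Prod.fst h
      simp only [R] at this
      rw [this]) (by
      rintro ⟨x, s⟩ ⟨hx, rfl⟩
      have h0 : HasFDerivAt f (fderiv ℝ f x) (A (x, 0)) := by rw [hA0]; exact hdf x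
      have h1 : HasFDerivAt R _ (x, (0:ℝ)) :=
        (hasFDerivAt_fst (𝕜 := ℝ) (p := (x, (0:ℝ)))).prodMk (h0.comp (x, (0:ℝ)) (hdA x))
      rw [h1.fderiv, injective_iff_map_eq_zero]
      rintro ⟨v, s⟩ hv
      simp only [ContinuousLinearMap.prod_apply, Prod.mk_eq_zero] at hv
      obtain ⟨hv1, hv2⟩ := hv
      have hv1 : v = 0 := hv1
      subst hv1
      have hv2 : fderiv ℝ f x (0 + s • gradient f x) = 0 := hv2
      rw [hfd, zero_add, inner_smul_right, mul_eq_zero, inner_self_eq_zero] at hv2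
      have hs : s = 0 := hv2.resolve_right (hgrad x hx)
      simp [hs])
  let Z := W ∩ W'
  have hZo : IsOpen Z := hWo.inter hWo'
  have hQZ : IsOpen (Q '' Z) := hWim Z inter_subset_left hZo
  have hRZ : IsOpen (R '' Z) := hWim' Z inter_subset_right hZo
  let Γ : Set (E × ℝ) := (fun x => (x, f x)) '' K
  have hΓ : IsCompact Γ := hK.image (continuous_id.prodMk hf.continuous)
  have hΓs : Γ ⊆ Q '' Z ∩ R '' Z := by
    rintro _ ⟨x, hx, rfl⟩
    have hz : ((x, 0) : E × ℝ) ∈ Z := ⟨hLW ⟨hx, rfl⟩, hLW' ⟨hx, rfl⟩⟩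
    exact ⟨⟨_, hz, by simp only [Q, hA0]⟩, ⟨_, hz, by simp only [R, hA0]⟩⟩
  obtain ⟨ε, hε, hεs⟩ := hΓ.exists_thickening_subset_open (hQZ.inter hRZ) hΓs
  have hmem : ∀ x ∈ K, ∀ c : ℝ, |c - f x| < ε → (x, c) ∈ Q '' Z ∩ R '' Z := by
    intro x hx c hc
    apply hεs
    rw [Metric.mem_thickening_iff]
    refine ⟨(x, f x), ⟨x, hx, rfl⟩, ?_⟩
    rw [Prod.dist_eq]
    simpa [Real.dist_eq, hε] using hc
  refine ⟨ε, hε, fun y y' hy hy' hyy => ?_⟩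
  have key1 : ∀ x ∈ f ⁻¹' {y}, (x, y') ∈ R '' Z := by
    intro x hx
    have hfx : f x = y := hx
    exact (hmem x (hy hx) y' (by rwa [hfx, abs_sub_comm])).2
  have key2 : ∀ x ∈ f ⁻¹' {y'}, (x, y) ∈ Q '' Z := by
    intro x hx
    have hfx : f x = y' := hx
    exact (hmem x (hy' hx) y (by rwa [hfx])).1
  have keyΦ : ∀ x ∈ f ⁻¹' {y}, f (A (τ (x, y'))) = y' ∧ (σ (A (τ (x, y')), y)).1 = x := by
    intro x hx
    have hfx : f x = y := hx
    obtain ⟨⟨x', s⟩, hz, he⟩ := key1 x hx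
    obtain ⟨rfl, hs⟩ := Prod.mk.inj he
    rw [← he, hτl _ hz.2]
    refine ⟨hs, ?_⟩
    have : (A (x', s), y) = Q (x', s) := by simp only [Q, ← hfx]
    rw [this, hσl _ hz.1]
  have keyΨ : ∀ x ∈ f ⁻¹' {y'}, f (σ (x, y)).1 = y ∧ A (τ ((σ (x, y)).1, y')) = x := by
    intro z hzz
    have hfz : f z = y' := hzz
    obtain ⟨⟨x, s⟩, hz, he⟩ := key2 z hzz
    obtain ⟨hs, hx⟩ := Prod.mk.inj he
    rw [← he, hσl _ hz.1]
    refine ⟨hx, ?_⟩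
    have : (x, y') = R (x, s) := by simp only [R, hs, hfz]
    rw [this, hτl _ hz.2, hs]
  refine ⟨(fun x => (x, y')) ⁻¹' (R '' Z), (fun x => (x, y)) ⁻¹' (Q '' Z),
    fun x => A (τ (x, y')), fun x => (σ (x, y)).1,
    hRZ.preimage (by fun_prop), hQZ.preimage (by fun_prop), key1, key2, ?_, ?_, ?_,
    fun x hx => (keyΦ x hx).2, fun x hx => (keyΨ x hx).2⟩
  · refine hA.comp_contDiffOn (hτ.comp (contDiff_id.prodMk contDiff_const).contDiffOn ?_)
    exact fun x hx => image_mono inter_subset_right hx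
  · refine contDiff_fst.comp_contDiffOn
      (hσ.comp (contDiff_id.prodMk contDiff_const).contDiffOn ?_)
    exact fun x hx => image_mono inter_subset_left hx
  · apply Subset.antisymm
    · rintro _ ⟨x, hx, rfl⟩
      exact (keyΦ x hx).1
    · intro z hz
      exact ⟨_, (keyΨ z hz).1, (keyΨ z hz).2⟩

/-- All the level sets `f⁻¹(y)`, `y` in an interval `[a,b]` free of critical points,
are diffeomorphic. -/
theorem levelSets_diffeomorphic
    (N : ℕ) (hN : 1 ≤ N) (f : EuclideanSpace ℝ (Fin N) → ℝ)
    (hf : ContDiff ℝ (⊤ : ℕ∞) f) (a b : ℝ) (hab : a < b)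
    (hK : IsCompact (f ⁻¹' Set.Icc a b))
    (C : ℝ) (hC : 0 < C)
    (hgrad : ∀ x ∈ f ⁻¹' Set.Icc a b, C ≤ ‖gradient f x‖)
    (y y' : ℝ) (hy : y ∈ Set.Icc a b) (hy' : y' ∈ Set.Icc a b) :
    ∃ (U U' : Set (EuclideanSpace ℝ (Fin N)))
      (Φ Ψ : EuclideanSpace ℝ (Fin N) → EuclideanSpace ℝ (Fin N)),
      IsOpen U ∧ IsOpen U' ∧
      f ⁻¹' {y} ⊆ U ∧ f ⁻¹' {y'} ⊆ U' ∧
      ContDiffOn ℝ (⊤ : ℕ∞) Φ U ∧ ContDiffOn ℝ (⊤ : ℕ∞) Ψ U' ∧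
      Φ '' (f ⁻¹' {y}) = f ⁻¹' {y'} ∧
      (∀ x ∈ f ⁻¹' {y}, Ψ (Φ x) = x) ∧
      (∀ x ∈ f ⁻¹' {y'}, Φ (Ψ x) = x) := by
  obtain ⟨ε, hε, H⟩ := exists_eps_setDiffeo f hf _ hK (by
    intro x hx h0
    have := hgrad x hx
    rw [h0, norm_zero] at this
    linarith)
  have hsub : ∀ c ∈ Icc a b, f ⁻¹' {c} ⊆ f ⁻¹' Icc a b :=
    fun c hc => preimage_mono (singleton_subset_iff.2 hc)
  have chain : ∀ n : ℕ, ∀ z ∈ Icc a b, |y - z| ≤ n * (ε / 2) →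
      SetDiffeo (f ⁻¹' {y}) (f ⁻¹' {z}) := by
    intro n
    induction n with
    | zero =>
      intro z hz h
      have : y = z := by
        have h' : |y - z| ≤ 0 := by simpa using h
        linarith [abs_nonpos_iff.1 h']
      rw [this]
      exact SetDiffeo.refl _
    | succ n ih =>
      intro z hz h
      have hp : (0 : ℝ) < n + 1 := by positivity
      have hmul : (y - z) = (n + 1) * ((y - z) / (n + 1)) := by field_simp
      set d := (y - z) / (n + 1) with hd
      have hdle : |d| ≤ ε / 2 := by
        rw [hmul, abs_mul, abs_of_pos hp] at h
        push_cast at h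
        exact le_of_mul_le_mul_left h hp
      have hn0 : (0 : ℝ) ≤ n := Nat.cast_nonneg n
      have hw : z + d ∈ Icc a b := by
        have : z + d = (n / (n + 1)) * z + (1 / (n + 1)) * y := by
          rw [hd]; field_simp; ring
        rw [this]
        exact convex_Icc a b hz hy (a := (n : ℝ) / (n + 1)) (b := 1 / ((n : ℝ) + 1)) (by positivity) (by positivity) (by field_simp)
      refine (ih (z + d) hw ?_).trans (H _ _ (hsub _ hw) (hsub _ hz) ?_)
      · have : y - (z + d) = n * d := by linarith
        rw [this, abs_mul, abs_of_nonneg hn0]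
        gcongr
      · have : z + d - z = d := by ring
        rw [this]
        linarith
  obtain ⟨n, hn⟩ := exists_nat_ge (|y - y'| / (ε / 2))
  exact chain n y' hy' ((div_le_iff₀ (by positivity)).1 hn)
end

section
/- Let N ≥ 1, let X ⊆ ℝ^N be open and let f : X → ℝ be twice continuously differentiable (C²) on X. Then for (Lebesgue) almost every a ∈ ℝ^N, the function x ↦ f(x) − ⟨a, x⟩ has only nondegenerate critical points on X; equivalently, for almost every a ∈ ℝ^N, every x ∈ X with ∇f(x) = a has invertible Hessian of f at x. -/
open Set MeasureTheory

/-- Genericity of Morse functions: for almost every linear perturbation `x ↦ f x - ⟪a, x⟫`,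
all critical points of the perturbed function (i.e. points where `∇f x = a`) are
nondegenerate. -/
theorem morse_genericity
    (N : ℕ) (hN : 1 ≤ N) (X : Set (EuclideanSpace ℝ (Fin N))) (hX : IsOpen X)
    (f : EuclideanSpace ℝ (Fin N) → ℝ) (hf : ContDiffOn ℝ 2 f X) :
    ∀ᵐ a : EuclideanSpace ℝ (Fin N) ∂volume,
      ∀ x ∈ X, gradient f x = a →
        ∃ e : EuclideanSpace ℝ (Fin N) ≃L[ℝ] EuclideanSpace ℝ (Fin N),
          (e : EuclideanSpace ℝ (Fin N) →L[ℝ] EuclideanSpace ℝ (Fin N)) =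
            fderiv ℝ (gradient f) x := by
  have hg : ∀ x ∈ X, DifferentiableAt ℝ (gradient f) x := by
    intro x hx
    have h1 : ContDiffAt ℝ 2 f x := hf.contDiffAt (hX.mem_nhds hx)
    have h2 : DifferentiableAt ℝ (fderiv ℝ f) x :=
      (h1.fderiv_right (m := 1) (by norm_num)).differentiableAt (by norm_num)
    exact ((InnerProductSpace.toDual ℝ
      (EuclideanSpace ℝ (Fin N))).symm.toContinuousLinearEquiv.differentiableAt).comp x h2
  have key : volume (gradient f '' {x | x ∈ X ∧ (fderiv ℝ (gradient f) x).det = 0}) = 0 :=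
    addHaar_image_eq_zero_of_det_fderivWithin_eq_zero volume
      (f' := fderiv ℝ (gradient f))
      (fun x hx => (hg x hx.1).hasFDerivAt.hasFDerivWithinAt) (fun x hx => hx.2)
  filter_upwards [measure_eq_zero_iff_ae_notMem.1 key] with a ha x hx hxa
  have hdet : (fderiv ℝ (gradient f) x).det ≠ 0 := fun h => ha ⟨x, ⟨hx, h⟩, hxa⟩
  exact ⟨(fderiv ℝ (gradient f) x).toContinuousLinearEquivOfDetNeZero hdet,
    ContinuousLinearMap.coe_toContinuousLinearEquivOfDetNeZero _ hdet⟩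
end

section
/- Let N ≥ 2 and 1 ≤ k ≤ N−1 be integers, let r > 0 and let ξ₀ < ξ₁ be reals. Then the N-dimensional Lebesgue measure of the set S = {(X,Y) ∈ ℝ^k × ℝ^{N−k} : ξ₀ ≤ ‖Y‖² − ‖X‖² ≤ ξ₁ and ‖X‖·‖Y‖ ≤ r} equals (1/2) · (2π^{k/2}/Γ(k/2)) · (2π^{(N−k)/2}/Γ((N−k)/2)) · ∫_{ξ₀}^{ξ₁} ( ∫_{√(max(ξ,0))}^{β(ξ,r)} y^{N−k−1} (y² − ξ)^{(k−2)/2} dy ) dξ, where Γ is the Gamma function. -/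
open MeasureTheory

lemma measurableSet_and {p q : ℝ × ℝ → Prop} (hp : MeasurableSet {x | p x})
    (hq : MeasurableSet {x | q x}) : MeasurableSet {x | p x ∧ q x} := hp.inter hq

/-- Surface area of the unit sphere. -/
noncomputable def sphArea (n : ℕ) : ℝ :=
  2 * Real.pi ^ ((n : ℝ) / 2) / Real.Gamma ((n : ℝ) / 2)

lemma sphArea_nonneg (n : ℕ) : 0 ≤ sphArea n := by
  unfold sphArea
  have : 0 ≤ Real.Gamma ((n : ℝ) / 2) := Real.Gamma_nonneg_of_nonneg (by positivity)
  positivity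

lemma toSphere_univ_eq (n : ℕ) (hn : 1 ≤ n) :
    (volume : Measure (EuclideanSpace ℝ (Fin n))).toSphere Set.univ
      = ENNReal.ofReal (sphArea n) := by
  have : Nonempty (Fin n) := ⟨⟨0, hn⟩⟩
  have hn0 : (0 : ℝ) < n := by exact_mod_cast hn
  rw [Measure.toSphere_apply_univ, EuclideanSpace.volume_ball]
  simp only [finrank_euclideanSpace, Fintype.card_fin, ENNReal.ofReal_one, one_pow, one_mul]
  rw [← ENNReal.ofReal_natCast, ← ENNReal.ofReal_mul (by positivity)]
  congr 1
  have h2 : Real.sqrt Real.pi ^ n = Real.pi ^ ((n : ℝ) / 2) := by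
    rw [Real.sqrt_eq_rpow, ← Real.rpow_natCast, ← Real.rpow_mul Real.pi_pos.le]
    congr 1; ring
  have h3 : Real.Gamma ((n : ℝ) / 2) ≠ 0 := (Real.Gamma_pos_of_pos (by positivity)).ne'
  rw [h2, Real.Gamma_add_one (by positivity), sphArea]
  field_simp

lemma lintegral_norm_eucl (n : ℕ) (hn : 1 ≤ n) (f : ℝ → ENNReal) (hf : Measurable f) :
    ∫⁻ x : EuclideanSpace ℝ (Fin n), f ‖x‖
      = ENNReal.ofReal (sphArea n) *
        ∫⁻ y in Set.Ioi (0 : ℝ), ENNReal.ofReal (y ^ (n - 1)) * f y := by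
  have : Nonempty (Fin n) := ⟨⟨0, hn⟩⟩
  have : Nontrivial (EuclideanSpace ℝ (Fin n)) := inferInstance
  let μ : Measure (EuclideanSpace ℝ (Fin n)) := volume
  calc
    ∫⁻ x, f ‖x‖ ∂μ = ∫⁻ x : ({(0)}ᶜ : Set (EuclideanSpace ℝ (Fin n))), f (‖x.1‖) ∂(μ.comap (↑)) := by
      rw [lintegral_subtype_comap (measurableSet_singleton _).compl fun x ↦ f (‖x‖),
        restrict_compl_singleton]
    _ = ∫⁻ x, f x.2 ∂μ.toSphere.prod (.volumeIoiPow (n - 1)) := by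
      have := μ.measurePreserving_homeomorphUnitSphereProd.lintegral_comp_emb
        (Homeomorph.measurableEmbedding _) (f ∘ Subtype.val ∘ Prod.snd)
      simpa using this
    _ = μ.toSphere Set.univ * ∫⁻ x : Set.Ioi (0 : ℝ), f x ∂.volumeIoiPow (n - 1) := by
      rw [lintegral_prod _ (by fun_prop)]
      simp [mul_comm]
    _ = _ := by
      rw [toSphere_univ_eq n hn, Measure.volumeIoiPow,
        lintegral_withDensity_eq_lintegral_mul _ (by fun_prop) (by fun_prop)]
      congr 1
      exact lintegral_subtype_comap measurableSet_Ioi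
        fun a ↦ ENNReal.ofReal (a ^ (n - 1)) * f a

/-- change of variables -/
lemma subst_xi (k : ℕ) (hk : 1 ≤ k) (y : ℝ) (g : ℝ → ℝ → ENNReal) :
    ∫⁻ x in Set.Ioi (0 : ℝ), ENNReal.ofReal (x ^ (k - 1)) * g x (y ^ 2 - x ^ 2)
     = ∫⁻ ξ in Set.Iio (y ^ 2), ENNReal.ofReal (1 / 2 * (y ^ 2 - ξ) ^ (((k : ℝ) - 2) / 2)) *
        g (Real.sqrt (y ^ 2 - ξ)) ξ := by
  have him : (fun x : ℝ => y ^ 2 - x ^ 2) '' Set.Ioi 0 = Set.Iio (y ^ 2) := by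
    ext ξ
    simp only [Set.mem_image, Set.mem_Ioi, Set.mem_Iio]
    constructor
    · rintro ⟨x, hx, rfl⟩
      have : 0 < x ^ 2 := by positivity
      linarith
    · intro h
      exact ⟨Real.sqrt (y ^ 2 - ξ), Real.sqrt_pos.2 (by linarith), by
        rw [Real.sq_sqrt (by linarith)]; ring⟩
  have hinj : Set.InjOn (fun x : ℝ => y ^ 2 - x ^ 2) (Set.Ioi 0) := by
    intro a ha b hb h
    have h : y ^ 2 - a ^ 2 = y ^ 2 - b ^ 2 := h
    have ha : 0 < a := ha
    have hb : 0 < b := hb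
    exact (sq_eq_sq₀ ha.le hb.le).1 (by linarith)
  rw [← him, lintegral_image_eq_lintegral_abs_deriv_mul (f' := fun x => -(2 * x))
    measurableSet_Ioi _ hinj]
  · refine setLIntegral_congr_fun measurableSet_Ioi ?_
    intro x hx
    have hx : 0 < x := hx
    have h1 : y ^ 2 - (y ^ 2 - x ^ 2) = x ^ 2 := by ring
    simp only [h1, Real.sqrt_sq hx.le]
    rw [← mul_assoc, ← ENNReal.ofReal_mul (abs_nonneg _)]
    congr 2
    rw [abs_neg, abs_of_pos (by positivity), ← Real.rpow_natCast, ← Real.rpow_natCast,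
      ← Real.rpow_mul hx.le]
    have : x ^ (((k - 1 : ℕ) : ℝ)) = x ^ (1 + ((2 : ℕ) : ℝ) * (((k : ℝ) - 2) / 2)) := by
      congr 1; push_cast [hk]; ring
    rw [this, Real.rpow_add hx, Real.rpow_one]; ring
  · intro x _
    have := ((hasDerivAt_id x).pow 2).const_sub (y ^ 2)
    simp at this
    exact this.hasDerivWithinAt

/-- the fibre over `ξ` -/
lemma fibre_iff (r : ℝ) (hr : 0 < r) (ξ y : ℝ) :
    (0 < y ∧ ξ < y ^ 2 ∧ Real.sqrt (y ^ 2 - ξ) * y ≤ r) ↔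
      y ∈ Set.Ioc (Real.sqrt (max ξ 0)) (Real.sqrt ((Real.sqrt (ξ ^ 2 + 4 * r ^ 2) + ξ) / 2)) := by
  have hs : Real.sqrt (ξ ^ 2 + 4 * r ^ 2) ^ 2 = ξ ^ 2 + 4 * r ^ 2 := Real.sq_sqrt (by positivity)
  have hs0 := Real.sqrt_nonneg (ξ ^ 2 + 4 * r ^ 2)
  set s := Real.sqrt (ξ ^ 2 + 4 * r ^ 2)
  have hab : |ξ| < s := by
    apply abs_lt_of_sq_lt_sq _ hs0
    nlinarith
  have h1 := neg_abs_le ξ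
  have key : 0 < y → ξ < y ^ 2 → (Real.sqrt (y ^ 2 - ξ) * y ≤ r ↔ y ≤ Real.sqrt ((s + ξ) / 2)) := by
    intro hy h
    rw [Real.le_sqrt hy.le (by linarith)]
    rw [← sq_le_sq₀ (by positivity) hr.le, mul_pow, Real.sq_sqrt (by linarith)]
    have e : (y ^ 2 - ξ) * y ^ 2 - r ^ 2 = (y ^ 2 - (s + ξ) / 2) * (y ^ 2 + (s - ξ) / 2) := by
      nlinarith
    have hp : 0 < y ^ 2 + (s - ξ) / 2 := by
      have := le_abs_self ξ
      have : 0 < y ^ 2 := by positivity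
      linarith
    constructor
    · intro h2
      by_contra h3
      push Not at h3
      have := mul_pos (sub_pos.2 h3) hp
      linarith
    · intro h2
      have := mul_nonneg (sub_nonneg.2 h2) hp.le
      nlinarith
  have k2 : (0 < y ∧ ξ < y ^ 2) ↔ Real.sqrt (max ξ 0) < y := by
    constructor
    · rintro ⟨h, h'⟩
      rw [Real.sqrt_lt' h]
      exact max_lt h' (by positivity)
    · intro h
      have hy := (Real.sqrt_nonneg _).trans_lt h
      rw [Real.sqrt_lt' hy] at h
      exact ⟨hy, (le_max_left _ _).trans_lt h⟩
  rw [Set.mem_Ioc, ← k2]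
  constructor
  · rintro ⟨a, b, c⟩; exact ⟨⟨a, b⟩, (key a b).1 c⟩
  · rintro ⟨⟨a, b⟩, c⟩; exact ⟨a, b, (key a b).2 c⟩

lemma vol_lt_top (k m : ℕ) (r : ℝ) (ξ₀ ξ₁ : ℝ) :
    volume {p : EuclideanSpace ℝ (Fin k) × EuclideanSpace ℝ (Fin m) |
        ξ₀ ≤ ‖p.2‖ ^ 2 - ‖p.1‖ ^ 2 ∧ ‖p.2‖ ^ 2 - ‖p.1‖ ^ 2 ≤ ξ₁ ∧ ‖p.1‖ * ‖p.2‖ ≤ r} < ⊤ := by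
  apply Bornology.IsBounded.measure_lt_top
  rw [isBounded_iff_forall_norm_le]
  refine ⟨1 + ((|ξ₀| + |ξ₁|) ^ 2 + 4 * r ^ 2), ?_⟩
  rintro ⟨X, Y⟩ ⟨h1, h2, h3⟩
  simp only at h1 h2 h3
  have hx := norm_nonneg X
  have hy := norm_nonneg Y
  set x := ‖X‖
  set y := ‖Y‖
  have a1 : |y ^ 2 - x ^ 2| ≤ |ξ₀| + |ξ₁| := by
    rw [abs_le]
    have := neg_abs_le ξ₀
    have := le_abs_self ξ₁
    have := abs_nonneg ξ₀
    have := abs_nonneg ξ₁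
    constructor <;> linarith
  have a2 : (y ^ 2 - x ^ 2) ^ 2 ≤ (|ξ₀| + |ξ₁|) ^ 2 := by
    rw [← sq_abs (y ^ 2 - x ^ 2)]
    gcongr
  have a3 : (x * y) ^ 2 ≤ r ^ 2 := by gcongr
  have a4 : (x ^ 2 + y ^ 2) ^ 2 ≤ (|ξ₀| + |ξ₁|) ^ 2 + 4 * r ^ 2 := by nlinarith
  have a5 : ∀ t : ℝ, t ≤ 1 + (t ^ 2) ^ 2 := by
    intro t; nlinarith [sq_nonneg (t - 1/2), sq_nonneg (t^2 - 1/2)]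
  rw [Prod.norm_def]
  apply max_le
  · have : (x ^ 2) ^ 2 ≤ (x ^ 2 + y ^ 2) ^ 2 := by gcongr; nlinarith
    have := a5 x
    change x ≤ _
    linarith
  · have : (y ^ 2) ^ 2 ≤ (x ^ 2 + y ^ 2) ^ 2 := by gcongr; nlinarith
    have := a5 y
    change y ≤ _
    linarith

/-- the integrand -/
noncomputable def integrand (k m : ℕ) (ξ y : ℝ) : ℝ :=
  y ^ (m - 1) * (y ^ 2 - ξ) ^ (((k : ℝ) - 2) / 2)

/-- the lintegral form -/
lemma vol_eq_lintegral (k m : ℕ) (hk : 1 ≤ k) (hm : 1 ≤ m)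
    (r : ℝ) (hr : 0 < r) (ξ₀ ξ₁ : ℝ) :
    volume {p : EuclideanSpace ℝ (Fin k) × EuclideanSpace ℝ (Fin m) |
        ξ₀ ≤ ‖p.2‖ ^ 2 - ‖p.1‖ ^ 2 ∧ ‖p.2‖ ^ 2 - ‖p.1‖ ^ 2 ≤ ξ₁ ∧ ‖p.1‖ * ‖p.2‖ ≤ r} =
      ENNReal.ofReal (1 / 2 * sphArea k * sphArea m) *
        ∫⁻ ξ in Set.Icc ξ₀ ξ₁, ∫⁻ y in Set.Ioc (Real.sqrt (max ξ 0))
          (Real.sqrt ((Real.sqrt (ξ ^ 2 + 4 * r ^ 2) + ξ) / 2)),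
            ENNReal.ofReal (integrand k m ξ y) := by
  classical
  let A : Set (ℝ × ℝ) := {q | ξ₀ ≤ q.2 ^ 2 - q.1 ^ 2 ∧ q.2 ^ 2 - q.1 ^ 2 ≤ ξ₁ ∧ q.1 * q.2 ≤ r}
  have hA : MeasurableSet A := by
    refine measurableSet_and ?_ (measurableSet_and ?_ ?_)
    · exact measurableSet_le (by fun_prop) (by fun_prop)
    · exact measurableSet_le (by fun_prop) (by fun_prop)
    · exact measurableSet_le (by fun_prop) (by fun_prop)
  let χ : ℝ × ℝ → ENNReal := A.indicator 1
  have hχ : Measurable χ := measurable_one.indicator hA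
  let T : Set (ℝ × ℝ) := {q | (q.1 ∈ Set.Icc ξ₀ ξ₁) ∧
    (0 < q.2 ∧ q.1 < q.2 ^ 2 ∧ Real.sqrt (q.2 ^ 2 - q.1) * q.2 ≤ r)}
  have hT : MeasurableSet T := by
    refine measurableSet_and (measurable_fst measurableSet_Icc)
      (measurableSet_and ?_ (measurableSet_and ?_ ?_))
    · exact measurableSet_lt (by fun_prop) (by fun_prop)
    · exact measurableSet_lt (by fun_prop) (by fun_prop)
    · exact measurableSet_le (by fun_prop) (by fun_prop)
  let H : ℝ → ℝ → ENNReal := fun y ξ =>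
    T.indicator (fun q => ENNReal.ofReal (1 / 2) * ENNReal.ofReal (integrand k m q.1 q.2)) (ξ, y)
  have hH : Measurable (Function.uncurry H) := by
    have h0 : Measurable (fun q : ℝ × ℝ =>
        ENNReal.ofReal (1 / 2) * ENNReal.ofReal (integrand k m q.1 q.2)) := by
      unfold integrand
      fun_prop
    exact (h0.indicator hT).comp measurable_swap
  have step1 : volume {p : EuclideanSpace ℝ (Fin k) × EuclideanSpace ℝ (Fin m) |
        ξ₀ ≤ ‖p.2‖ ^ 2 - ‖p.1‖ ^ 2 ∧ ‖p.2‖ ^ 2 - ‖p.1‖ ^ 2 ≤ ξ₁ ∧ ‖p.1‖ * ‖p.2‖ ≤ r} =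
      ∫⁻ Y : EuclideanSpace ℝ (Fin m), ∫⁻ X : EuclideanSpace ℝ (Fin k), χ (‖X‖, ‖Y‖) := by
    rw [← lintegral_prod_symm (fun p : EuclideanSpace ℝ (Fin k) × EuclideanSpace ℝ (Fin m) =>
      χ (‖p.1‖, ‖p.2‖)) (by fun_prop), ← Measure.volume_eq_prod, ← lintegral_indicator_one]
    · rfl
    · exact (measurable_fst.norm.prodMk measurable_snd.norm) hA
  rw [step1]
  have step2 : ∀ y : ℝ, ∫⁻ X : EuclideanSpace ℝ (Fin k), χ (‖X‖, y) = ENNReal.ofReal (sphArea k) *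
      ∫⁻ x in Set.Ioi (0 : ℝ), ENNReal.ofReal (x ^ (k - 1)) * χ (x, y) := fun y =>
    lintegral_norm_eucl k hk (fun x => χ (x, y)) (by fun_prop)
  have hinner : Measurable (fun y : ℝ =>
      ∫⁻ x in Set.Ioi (0 : ℝ), ENNReal.ofReal (x ^ (k - 1)) * χ (x, y)) := by
    apply Measurable.lintegral_prod_right'
      (f := fun p : ℝ × ℝ => ENNReal.ofReal (p.2 ^ (k - 1)) * χ (p.2, p.1))
    fun_prop
  have step3 : ∀ y ∈ Set.Ioi (0 : ℝ), ENNReal.ofReal (y ^ (m - 1)) *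
      (∫⁻ x in Set.Ioi (0 : ℝ), ENNReal.ofReal (x ^ (k - 1)) * χ (x, y)) = ∫⁻ ξ, H y ξ := by
    intro y hy
    have hy : 0 < y := hy
    have := subst_xi k hk y
      (fun x ξ => if ξ₀ ≤ ξ ∧ ξ ≤ ξ₁ ∧ x * y ≤ r then 1 else 0)
    have e : ∀ x, χ (x, y) = if ξ₀ ≤ y ^ 2 - x ^ 2 ∧ y ^ 2 - x ^ 2 ≤ ξ₁ ∧ x * y ≤ r
        then 1 else 0 := fun x => by
      simp [χ, A, Set.indicator_apply]
    simp only [e]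
    rw [this, ← lintegral_const_mul' _ _ ENNReal.ofReal_ne_top,
      ← lintegral_indicator measurableSet_Iio]
    refine lintegral_congr fun ξ => ?_
    by_cases h1 : ξ < y ^ 2
    · rw [Set.indicator_of_mem (by exact h1)]
      by_cases h2 : ξ₀ ≤ ξ ∧ ξ ≤ ξ₁ ∧ Real.sqrt (y ^ 2 - ξ) * y ≤ r
      · have : (ξ, y) ∈ T := ⟨⟨h2.1, h2.2.1⟩, hy, h1, h2.2.2⟩
        simp only [H, Set.indicator_of_mem this, h2, and_self, if_true, mul_one, integrand]
        rw [← ENNReal.ofReal_mul (by positivity), ← ENNReal.ofReal_mul (by positivity)]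
        congr 1; ring
      · have : (ξ, y) ∉ T := fun h => h2 ⟨h.1.1, h.1.2, h.2.2.2⟩
        simp only [H, Set.indicator_of_notMem this, if_neg h2, mul_zero]
    · have : (ξ, y) ∉ T := fun h => h1 h.2.2.1
      rw [Set.indicator_of_notMem (by exact h1)]
      simp only [H, Set.indicator_of_notMem this]
  have step4 : ∫⁻ y in Set.Ioi (0 : ℝ), ∫⁻ ξ, H y ξ = ∫⁻ y, ∫⁻ ξ, H y ξ := by
    rw [← lintegral_indicator measurableSet_Ioi]
    refine lintegral_congr fun y => ?_
    by_cases hy : 0 < y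
    · rw [Set.indicator_of_mem (by exact hy)]
    · rw [Set.indicator_of_notMem (by exact hy)]
      have : ∀ ξ, H y ξ = 0 := fun ξ =>
        Set.indicator_of_notMem (fun h => hy h.2.1) _
      simp [this]
  have step5 : ∫⁻ y, ∫⁻ ξ, H y ξ = ENNReal.ofReal (1 / 2) *
      ∫⁻ ξ in Set.Icc ξ₀ ξ₁, ∫⁻ y in Set.Ioc (Real.sqrt (max ξ 0))
          (Real.sqrt ((Real.sqrt (ξ ^ 2 + 4 * r ^ 2) + ξ) / 2)),
            ENNReal.ofReal (integrand k m ξ y) := by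
    rw [lintegral_lintegral_swap hH.aemeasurable,
      ← lintegral_const_mul' _ _ ENNReal.ofReal_ne_top, ← lintegral_indicator measurableSet_Icc]
    refine lintegral_congr fun ξ => ?_
    by_cases h : ξ ∈ Set.Icc ξ₀ ξ₁
    · rw [Set.indicator_of_mem h, ← lintegral_const_mul' _ _ ENNReal.ofReal_ne_top,
        ← lintegral_indicator measurableSet_Ioc]
      refine lintegral_congr fun y => ?_
      simp only [H, Set.indicator_apply]
      have : (ξ, y) ∈ T ↔ y ∈ Set.Ioc (Real.sqrt (max ξ 0))
          (Real.sqrt ((Real.sqrt (ξ ^ 2 + 4 * r ^ 2) + ξ) / 2)) := by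
        rw [← fibre_iff r hr]
        exact ⟨fun q => q.2, fun q => ⟨h, q⟩⟩
      simp only [this]
    · rw [Set.indicator_of_notMem h]
      have : ∀ y, H y ξ = 0 := fun y =>
        Set.indicator_of_notMem (fun q => h q.1) _
      simp [this]
  simp only [step2]
  rw [lintegral_norm_eucl m hm (fun y => ENNReal.ofReal (sphArea k) *
      ∫⁻ x in Set.Ioi (0 : ℝ), ENNReal.ofReal (x ^ (k - 1)) * χ (x, y)) (hinner.const_mul _)]
  simp only [mul_left_comm _ (ENNReal.ofReal (sphArea k))]
  rw [lintegral_const_mul' _ _ ENNReal.ofReal_ne_top,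
    setLIntegral_congr_fun measurableSet_Ioi step3, step4, step5,
    ENNReal.ofReal_mul (mul_nonneg (by norm_num) (sphArea_nonneg k)),
    ENNReal.ofReal_mul (by norm_num)]
  ring

/-- The volume of the portion of the pseudo-cylindrical neighborhood of a critical point
of Morse index `k`, in Morse coordinates, comprised between the level sets labelled by
`ξ₀` and `ξ₁`. -/
theorem volume_pseudoCylinder
    (N k : ℕ) (hN : 2 ≤ N) (hk1 : 1 ≤ k) (hkN : k ≤ N - 1)
    (r : ℝ) (hr : 0 < r) (ξ₀ ξ₁ : ℝ) (hξ : ξ₀ < ξ₁) :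
    volume {p : EuclideanSpace ℝ (Fin k) × EuclideanSpace ℝ (Fin (N - k)) |
        ξ₀ ≤ ‖p.2‖ ^ 2 - ‖p.1‖ ^ 2 ∧ ‖p.2‖ ^ 2 - ‖p.1‖ ^ 2 ≤ ξ₁ ∧ ‖p.1‖ * ‖p.2‖ ≤ r} =
      ENNReal.ofReal ((1 / 2) *
        (2 * Real.pi ^ ((k : ℝ) / 2) / Real.Gamma ((k : ℝ) / 2)) *
        (2 * Real.pi ^ (((N : ℝ) - k) / 2) / Real.Gamma (((N : ℝ) - k) / 2)) *
        ∫ ξ in ξ₀..ξ₁,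
          ∫ y in Real.sqrt (max ξ 0)..Real.sqrt ((Real.sqrt (ξ ^ 2 + 4 * r ^ 2) + ξ) / 2),
            y ^ (N - k - 1) * (y ^ 2 - ξ) ^ (((k : ℝ) - 2) / 2)) := by
  have hm : 1 ≤ N - k := by omega
  have hcast : ((N - k : ℕ) : ℝ) = (N : ℝ) - k := Nat.cast_sub (by omega)
  have hV := vol_eq_lintegral k (N - k) hk1 hm r hr ξ₀ ξ₁
  have hfin := vol_lt_top k (N - k) r ξ₀ ξ₁
  rw [hV] at hfin ⊢
  have hsm : 2 * Real.pi ^ (((N : ℝ) - k) / 2) / Real.Gamma (((N : ℝ) - k) / 2)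
      = sphArea (N - k) := by rw [sphArea, hcast]
  have hsk : 2 * Real.pi ^ ((k : ℝ) / 2) / Real.Gamma ((k : ℝ) / 2) = sphArea k := rfl
  have spos : ∀ n : ℕ, 1 ≤ n → 0 < sphArea n := by
    intro n hn
    have hn0 : (0 : ℝ) < n := by exact_mod_cast hn
    have : 0 < Real.Gamma ((n : ℝ) / 2) := Real.Gamma_pos_of_pos (by positivity)
    unfold sphArea
    positivity
  have hCpos : 0 < 1 / 2 * sphArea k * sphArea (N - k) := by
    have := spos k hk1
    have := spos (N - k) hm
    positivity
  rw [hsm, hsk, ENNReal.ofReal_mul hCpos.le]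
  congr 1
  set F : ℝ → ENNReal := fun ξ => ∫⁻ y in Set.Ioc (Real.sqrt (max ξ 0))
          (Real.sqrt ((Real.sqrt (ξ ^ 2 + 4 * r ^ 2) + ξ) / 2)),
            ENNReal.ofReal (integrand k (N - k) ξ y) with hF
  have hFint : ∫⁻ ξ in Set.Icc ξ₀ ξ₁, F ξ ≠ ⊤ := by
    intro h
    rw [h, ENNReal.mul_top (by simpa using hCpos)] at hfin
    exact lt_irrefl _ hfin
  have hFm : Measurable F := by
    have e : F = fun ξ => ∫⁻ y, {q : ℝ × ℝ | Real.sqrt (max q.1 0) < q.2 ∧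
        q.2 ≤ Real.sqrt ((Real.sqrt (q.1 ^ 2 + 4 * r ^ 2) + q.1) / 2)}.indicator
        (fun q => ENNReal.ofReal (integrand k (N - k) q.1 q.2)) (ξ, y) := by
      funext ξ
      rw [hF]
      simp only
      rw [← lintegral_indicator measurableSet_Ioc]
      rfl
    rw [e]
    apply Measurable.lintegral_prod_right'
    refine Measurable.indicator (by unfold integrand; fun_prop) ?_
    refine measurableSet_and ?_ ?_
    · exact measurableSet_lt (by fun_prop) (by fun_prop)
    · exact measurableSet_le (by fun_prop) (by fun_prop)
  have hinner : ∀ ξ : ℝ, (∫ y in Real.sqrt (max ξ 0)..Real.sqrt ((Real.sqrt (ξ ^ 2 + 4 * r ^ 2) + ξ) / 2),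
            y ^ (N - k - 1) * (y ^ 2 - ξ) ^ (((k : ℝ) - 2) / 2)) = (F ξ).toReal := by
    intro ξ
    have hle : Real.sqrt (max ξ 0) ≤ Real.sqrt ((Real.sqrt (ξ ^ 2 + 4 * r ^ 2) + ξ) / 2) := by
      apply Real.sqrt_le_sqrt
      have : |ξ| ≤ Real.sqrt (ξ ^ 2 + 4 * r ^ 2) := by
        apply Real.abs_le_sqrt
        nlinarith [sq_nonneg r]
      have := le_abs_self ξ
      have := neg_abs_le ξ
      apply max_le <;> linarith
    rw [intervalIntegral.integral_of_le hle, integral_eq_lintegral_of_nonneg_ae]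
    · rfl
    · filter_upwards [ae_restrict_mem measurableSet_Ioc] with y hy
      have hy' := (fibre_iff r hr ξ y).2 hy
      have h0 := hy'.1
      have h1 : 0 ≤ y ^ 2 - ξ := by linarith [hy'.2.1]
      simp only [Pi.zero_apply]
      positivity
    · exact Measurable.aestronglyMeasurable (by fun_prop)
  simp only [hinner]
  rw [intervalIntegral.integral_of_le hξ.le, restrict_Ioc_eq_restrict_Icc,
    integral_toReal hFm.aemeasurable (ae_lt_top hFm hFint), ENNReal.ofReal_toReal hFint]
end

section
/- Let N ≥ 2 and 1 ≤ k ≤ N−1 be integers and let r > 0. Then the function F₊ : ξ ↦ ∫_{√ξ}^{β(ξ,r)} y^{N−k−1} (y² − ξ)^{(k−2)/2} dy is C^∞ on the open interval (0, ∞), and the function F₋ : ξ ↦ ∫_{0}^{β(ξ,r)} y^{N−k−1} (y² − ξ)^{(k−2)/2} dy is C^∞ on the open interval (−∞, 0). -/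
lemma aux_arg_pos (r : ℝ) (hr : 0 < r) (ξ : ℝ) :
    |ξ| < Real.sqrt (ξ ^ 2 + 4 * r ^ 2) := by
  rw [← Real.sqrt_sq_eq_abs]
  apply Real.sqrt_lt_sqrt (sq_nonneg _)
  have : 0 < r ^ 2 := by positivity
  linarith

lemma aux_beta_smooth (r : ℝ) (hr : 0 < r) :
    ContDiff ℝ (⊤ : ℕ∞)
      (fun ξ : ℝ => Real.sqrt ((Real.sqrt (ξ ^ 2 + 4 * r ^ 2) + ξ) / 2)) := by
  apply ContDiff.sqrt
  · apply ContDiff.div_const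
    apply ContDiff.add _ contDiff_id
    apply ContDiff.sqrt
    · fun_prop
    · intro x
      positivity
  · intro x
    have h1 := aux_arg_pos r hr x
    have h2 := neg_abs_le x
    have : 0 < (Real.sqrt (x ^ 2 + 4 * r ^ 2) + x) / 2 := by linarith
    exact this.ne'

/-- A primitive of a function smooth on an open set is smooth there. -/
lemma aux_primitive (f : ℝ → ℝ) (a : ℝ) (U : Set ℝ) (hU : IsOpen U)
    (hf : ContDiffOn ℝ (⊤ : ℕ∞) f U) (hm : Measurable f)
    (hi : ∀ x ∈ U, IntervalIntegrable f MeasureTheory.volume a x) :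
    ContDiffOn ℝ (⊤ : ℕ∞) (fun x => ∫ y in a..x, f y) U := by
  have hd : ∀ x ∈ U, HasDerivAt (fun x => ∫ y in a..x, f y) (f x) x := by
    intro x hx
    apply intervalIntegral.integral_hasDerivAt_right (hi x hx)
    · exact hm.stronglyMeasurable.stronglyMeasurableAtFilter
    · exact hf.continuousOn.continuousAt (hU.mem_nhds hx)
  rw [contDiffOn_infty_iff_deriv_of_isOpen hU]
  refine ⟨fun x hx => (hd x hx).differentiableAt.differentiableWithinAt, ?_⟩
  exact hf.congr fun x hx => (hd x hx).deriv

lemma aux_plus (m : ℕ) (p : ℝ) (hp : -1 < p) :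
    ContDiffOn ℝ (⊤ : ℕ∞) (fun x : ℝ => ∫ y in (1:ℝ)..x, y ^ m * (y ^ 2 - 1) ^ p)
      (Set.Ioi 1) := by
  apply aux_primitive _ _ _ isOpen_Ioi
  · apply ContDiffOn.mul (by fun_prop)
    apply ContDiffOn.rpow_const_of_ne (by fun_prop)
    intro x hx
    have : (1:ℝ) < x := hx
    nlinarith
  · fun_prop
  · intro x hx
    have hx : (1:ℝ) < x := hx
    have h1 : IntervalIntegrable (fun y : ℝ => (y - 1) ^ p) MeasureTheory.volume 1 x := by
      have := (intervalIntegral.intervalIntegrable_rpow' (a := 0) (b := x - 1) hp).comp_sub_right 1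
      simpa using this
    have h2 : IntervalIntegrable (fun y : ℝ => (y - 1) ^ p * (y ^ m * (y + 1) ^ p))
        MeasureTheory.volume 1 x := by
      apply h1.mul_continuousOn
      apply ContinuousOn.mul (by fun_prop)
      apply ContinuousOn.rpow_const (by fun_prop)
      intro y hy
      rw [Set.uIcc_of_le hx.le] at hy
      left
      linarith [hy.1]
    refine h2.congr ?_
    intro y hy
    rw [Set.uIoc_of_le hx.le] at hy
    have h3 : (1:ℝ) < y := hy.1
    have : y ^ 2 - 1 = (y - 1) * (y + 1) := by ring
    simp only []
    rw [this, Real.mul_rpow (by linarith) (by linarith)]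
    ring

lemma aux_minus (m : ℕ) (p : ℝ) :
    ContDiffOn ℝ (⊤ : ℕ∞) (fun x : ℝ => ∫ y in (0:ℝ)..x, y ^ m * (y ^ 2 + 1) ^ p)
      Set.univ := by
  have h : ContDiff ℝ (⊤ : ℕ∞) (fun y : ℝ => y ^ m * (y ^ 2 + 1) ^ p) := by
    apply ContDiff.mul (by fun_prop)
    apply ContDiff.rpow_const_of_ne (by fun_prop)
    intro x
    positivity
  apply aux_primitive _ _ _ isOpen_univ h.contDiffOn
  · fun_prop
  · intro x _
    exact h.continuous.intervalIntegrable _ _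

/-- Scaling: pull out the parameter. -/
lemma aux_scale (m : ℕ) (p s σ a b : ℝ) (hs : 0 < s)
    (hσ : ∀ y ∈ Set.uIcc a (b / Real.sqrt s), 0 ≤ y ^ 2 + σ) :
    (∫ y in (Real.sqrt s * a)..b, y ^ m * (y ^ 2 + σ * s) ^ p) =
      Real.sqrt s ^ (m + 1) * s ^ p *
        ∫ y in a..(b / Real.sqrt s), y ^ m * (y ^ 2 + σ) ^ p := by
  have hq : 0 < Real.sqrt s := Real.sqrt_pos.2 hs
  have hb : b = Real.sqrt s * (b / Real.sqrt s) := by field_simp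
  conv_lhs => rw [hb]
  rw [← intervalIntegral.mul_integral_comp_mul_left, ← intervalIntegral.integral_const_mul,
    ← intervalIntegral.integral_const_mul]
  apply intervalIntegral.integral_congr
  intro y hy
  have h1 : (Real.sqrt s * y) ^ 2 + σ * s = s * (y ^ 2 + σ) := by
    rw [mul_pow, Real.sq_sqrt hs.le]; ring
  simp only []
  rw [h1, Real.mul_rpow hs.le (hσ y hy)]
  ring

/-- Smoothness of the one-dimensional integrals `F₊` and `F₋` to which the volume of a
pseudo-cylindrical neighborhood of a critical point of Morse index `k` reduces, for level
values above and below the critical value respectively. -/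
theorem F_plus_minus_smooth (N k : ℕ) (hN : 2 ≤ N) (hk1 : 1 ≤ k) (hkN : k ≤ N - 1)
    (r : ℝ) (hr : 0 < r) :
    ContDiffOn ℝ (⊤ : ℕ∞)
      (fun ξ : ℝ =>
        ∫ y in Real.sqrt ξ..Real.sqrt ((Real.sqrt (ξ ^ 2 + 4 * r ^ 2) + ξ) / 2),
          y ^ (N - k - 1) * (y ^ 2 - ξ) ^ (((k : ℝ) - 2) / 2))
      (Set.Ioi (0 : ℝ)) ∧
    ContDiffOn ℝ (⊤ : ℕ∞)
      (fun ξ : ℝ =>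
        ∫ y in (0 : ℝ)..Real.sqrt ((Real.sqrt (ξ ^ 2 + 4 * r ^ 2) + ξ) / 2),
          y ^ (N - k - 1) * (y ^ 2 - ξ) ^ (((k : ℝ) - 2) / 2))
      (Set.Iio (0 : ℝ)) := by
  have hβ := aux_beta_smooth r hr
  have hp : -1 < ((k : ℝ) - 2) / 2 := by
    have : (1:ℝ) ≤ k := by exact_mod_cast hk1
    linarith
  generalize ((k : ℝ) - 2) / 2 = p at hp ⊢
  generalize N - k - 1 = m
  constructor
  · have hgt : ∀ ξ : ℝ, 0 < ξ →
        1 < Real.sqrt ((Real.sqrt (ξ ^ 2 + 4 * r ^ 2) + ξ) / 2) / Real.sqrt ξ := by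
      intro ξ hξ
      rw [lt_div_iff₀ (Real.sqrt_pos.2 hξ), one_mul]
      apply Real.sqrt_lt_sqrt hξ.le
      have := aux_arg_pos r hr ξ
      rw [abs_of_pos hξ] at this
      linarith
    have hs : ContDiffOn ℝ (⊤ : ℕ∞) (fun ξ : ℝ => Real.sqrt ξ) (Set.Ioi 0) :=
      contDiffOn_id.sqrt fun x hx => ne_of_gt hx
    have hmain : ContDiffOn ℝ (⊤ : ℕ∞) (fun ξ : ℝ => Real.sqrt ξ ^ (m + 1) * ξ ^ p *
        (fun x : ℝ => ∫ y in (1:ℝ)..x, y ^ m * (y ^ 2 - 1) ^ p)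
          (Real.sqrt ((Real.sqrt (ξ ^ 2 + 4 * r ^ 2) + ξ) / 2) / Real.sqrt ξ)) (Set.Ioi 0) := by
      apply ContDiffOn.mul
      · exact (hs.pow _).mul (contDiffOn_id.rpow_const_of_ne fun x hx => ne_of_gt hx)
      · apply (aux_plus m p hp).comp
          (hβ.contDiffOn.div hs fun x hx => (Real.sqrt_pos.2 hx).ne')
        intro ξ hξ
        exact hgt ξ hξ
    refine hmain.congr ?_
    intro ξ hξ
    have := aux_scale m p ξ (-1) 1 (Real.sqrt ((Real.sqrt (ξ ^ 2 + 4 * r ^ 2) + ξ) / 2)) hξ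
      (by
        intro y hy
        rw [Set.uIcc_of_le (hgt ξ hξ).le] at hy
        nlinarith [hy.1])
    simpa [← sub_eq_add_neg] using this
  · have hs : ContDiffOn ℝ (⊤ : ℕ∞) (fun ξ : ℝ => Real.sqrt (-ξ)) (Set.Iio 0) :=
      contDiffOn_id.neg.sqrt fun x hx => neg_ne_zero.2 (ne_of_lt hx)
    have hmain : ContDiffOn ℝ (⊤ : ℕ∞) (fun ξ : ℝ => Real.sqrt (-ξ) ^ (m + 1) * (-ξ) ^ p *
        (fun x : ℝ => ∫ y in (0:ℝ)..x, y ^ m * (y ^ 2 + 1) ^ p)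
          (Real.sqrt ((Real.sqrt (ξ ^ 2 + 4 * r ^ 2) + ξ) / 2) / Real.sqrt (-ξ)))
        (Set.Iio 0) := by
      apply ContDiffOn.mul
      · exact (hs.pow _).mul
          (contDiffOn_id.neg.rpow_const_of_ne fun x hx => neg_ne_zero.2 (ne_of_lt hx))
      · apply (aux_minus m p).comp
          (hβ.contDiffOn.div hs fun x hx => (Real.sqrt_pos.2 (neg_pos.2 hx)).ne')
        intro ξ hξ
        exact Set.mem_univ _
    refine hmain.congr ?_
    intro ξ hξ
    have := aux_scale m p (-ξ) 1 0 (Real.sqrt ((Real.sqrt (ξ ^ 2 + 4 * r ^ 2) + ξ) / 2))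
      (neg_pos.2 hξ) (by intro y hy; positivity)
    simpa [← sub_eq_add_neg] using this
end

section
/- Let N ≥ 1 and let V : ℝ^N → ℝ be C^∞. Suppose q_c is a nondegenerate critical point of V, i.e. ∇V(q_c) = 0 and the Hessian of V at q_c is invertible, and let k (0 ≤ k ≤ N) be the number of negative eigenvalues of the Hessian of V at q_c (its Morse index). Then there exist open neighborhoods U of 0 and W of q_c in ℝ^N and a map φ : U → W with φ(0) = q_c, such that φ is a bijection from U onto W, φ is C^∞ on U, its inverse is C^∞ on W, and for every x ∈ U, V(φ(x)) = V(q_c) − Σ_{l=1}^{k} x_l² + Σ_{l=k+1}^{N} x_l². -/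
open Set

open MeasureTheory in
theorem morse_aux_hasFDerivAt_integral {E F : Type} [NormedAddCommGroup E] [NormedSpace ℝ E]
    [FiniteDimensional ℝ E] [NormedAddCommGroup F] [NormedSpace ℝ F] [CompleteSpace F]
    (f : E × ℝ → F) (hf : ContDiff ℝ (⊤ : ℕ∞) f) (x₀ : E) :
    HasFDerivAt (fun x => ∫ t in (0:ℝ)..1, f (x, t))
      (∫ t in (0:ℝ)..1, (fderiv ℝ f (x₀, t)).comp (ContinuousLinearMap.inl ℝ E ℝ)) x₀ := by
  have hfd : ContDiff ℝ (⊤ : ℕ∞) (fderiv ℝ f) := hf.fderiv_right (by simp)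
  have hc : Continuous (fun p : E × ℝ => (fderiv ℝ f p).comp (ContinuousLinearMap.inl ℝ E ℝ)) :=
    hfd.continuous.clm_comp continuous_const
  have hK : IsCompact (Metric.closedBall x₀ 1 ×ˢ Icc (0:ℝ) 1) :=
    (isCompact_closedBall x₀ 1).prod isCompact_Icc
  obtain ⟨C, hC⟩ := hK.exists_bound_of_continuousOn hc.continuousOn
  refine (intervalIntegral.hasFDerivAt_integral_of_dominated_of_fderiv_le
    (F := fun x t => f (x, t))
    (F' := fun x t => (fderiv ℝ f (x, t)).comp (ContinuousLinearMap.inl ℝ E ℝ))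
    (bound := fun _ => C) (Metric.closedBall_mem_nhds x₀ one_pos) ?_ ?_ ?_ ?_ ?_ ?_)
  · refine Filter.Eventually.of_forall fun x => ?_
    exact (hf.continuous.comp (by fun_prop : Continuous fun t : ℝ => (x, t))).aestronglyMeasurable
  · exact (hf.continuous.comp (by fun_prop : Continuous fun t : ℝ => (x₀, t))).intervalIntegrable _ _
  · exact (hc.comp (by fun_prop : Continuous fun t : ℝ => (x₀, t))).aestronglyMeasurable
  · refine Filter.Eventually.of_forall fun t ht x hx => ?_
    rw [uIoc_of_le zero_le_one] at ht
    exact hC (x, t) ⟨hx, ht.1.le, ht.2⟩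
  · simp
  · refine Filter.Eventually.of_forall fun t ht x hx => ?_
    have h1 : HasFDerivAt f (fderiv ℝ f (x, t)) (x, t) :=
      (hf.differentiable (by simp)).differentiableAt.hasFDerivAt
    exact HasFDerivAt.comp (f := fun x => (x, t)) x h1 (hasFDerivAt_prodMk_left x t)

theorem morse_aux_contDiff_integral_nat {E : Type} [NormedAddCommGroup E] [NormedSpace ℝ E]
    [FiniteDimensional ℝ E] (n : ℕ) : ∀ (F : Type) [NormedAddCommGroup F] [NormedSpace ℝ F]
    [CompleteSpace F] (f : E × ℝ → F) (_ : ContDiff ℝ (⊤ : ℕ∞) f),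
    ContDiff ℝ n (fun x => ∫ t in (0:ℝ)..1, f (x, t)) := by
  induction n with
  | zero =>
    intro F _ _ _ f hf
    refine contDiff_zero.2 (continuous_iff_continuousAt.2 fun x => ?_)
    exact (morse_aux_hasFDerivAt_integral f hf x).continuousAt
  | succ n ih =>
    intro F _ _ _ f hf
    have hfd : ContDiff ℝ (⊤ : ℕ∞) (fderiv ℝ f) := hf.fderiv_right (by simp)
    have := ih (E →L[ℝ] F) (fun p => (fderiv ℝ f p).comp (ContinuousLinearMap.inl ℝ E ℝ))
      (hfd.clm_comp contDiff_const)
    refine contDiff_succ_iff_hasFDerivAt.2 ⟨_, this, fun x => ?_⟩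
    exact morse_aux_hasFDerivAt_integral f hf x

theorem morse_aux_contDiff_integral {E F : Type} [NormedAddCommGroup E] [NormedSpace ℝ E]
    [FiniteDimensional ℝ E] [NormedAddCommGroup F] [NormedSpace ℝ F] [CompleteSpace F]
    (f : E × ℝ → F) (hf : ContDiff ℝ (⊤ : ℕ∞) f) :
    ContDiff ℝ (⊤ : ℕ∞) (fun x => ∫ t in (0:ℝ)..1, f (x, t)) :=
  contDiff_infty.2 fun n => morse_aux_contDiff_integral_nat n F f hf

/-- Smooth inverse function theorem on a neighborhood. -/
theorem morse_aux_inverse {E : Type} [NormedAddCommGroup E] [NormedSpace ℝ E] [CompleteSpace E]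
    (f : E → E) (O : Set E) (hO : IsOpen O) (a : E) (ha : a ∈ O)
    (hf : ContDiffOn ℝ (⊤ : ℕ∞) f O) (e : E ≃L[ℝ] E) (he : HasFDerivAt f (e : E →L[ℝ] E) a) :
    ∃ P : OpenPartialHomeomorph E E, (∀ x, P x = f x) ∧ a ∈ P.source ∧ P.source ⊆ O ∧
      ContDiffOn ℝ (⊤ : ℕ∞) P.symm P.target := by
  have hfa : ∀ x ∈ O, ContDiffAt ℝ (⊤ : ℕ∞) f x := fun x hx => hf.contDiffAt (hO.mem_nhds hx)
  let P₀ := (hfa a ha).toOpenPartialHomeomorph f he (by simp)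
  have hcont : ContinuousOn (fderiv ℝ f) O := hf.continuousOn_fderiv_of_isOpen hO (by simp)
  have hO' : IsOpen (O ∩ fderiv ℝ f ⁻¹' (range ((↑) : (E ≃L[ℝ] E) → E →L[ℝ] E))) :=
    hcont.isOpen_inter_preimage hO ContinuousLinearEquiv.isOpen
  set O' := O ∩ fderiv ℝ f ⁻¹' (range ((↑) : (E ≃L[ℝ] E) → E →L[ℝ] E))
  have haO' : a ∈ O' := ⟨ha, e, he.fderiv.symm⟩
  have hP₀ : ∀ x, P₀ x = f x := fun x => rfl
  refine ⟨P₀.restrOpen O' hO', fun x => rfl, ?_, ?_, ?_⟩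
  · exact ⟨(hfa a ha).mem_toOpenPartialHomeomorph_source he (by simp), haO'⟩
  · exact fun x hx => hx.2.1
  · intro y hy
    set P := P₀.restrOpen O' hO'
    have hx : P.symm y ∈ P.source := P.map_target hy
    obtain ⟨e', he'⟩ := hx.2.2
    refine ContDiffAt.contDiffWithinAt (P.contDiffAt_symm (f₀' := e') hy ?_ (hfa _ hx.2.1))
    rw [he']
    exact ((hfa _ hx.2.1).differentiableAt (by simp)).hasFDerivAt

/-- A smooth square root of congruence near a selfadjoint invertible element. -/
theorem morse_aux_sqrt {A : Type} [NormedRing A] [NormedAlgebra ℝ A] [CompleteSpace A]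
    [StarRing A] [ContinuousStar A] (b c : A) (hbc : b * c = 1) (hcb : c * b = 1)
    (hb : star b = b) :
    ∃ (T : Set A) (R : A → A), IsOpen T ∧ b ∈ T ∧ ContDiffOn ℝ (⊤ : ℕ∞) R T ∧ R b = 1 ∧
      ∀ x ∈ T, star x = x → star (R x) * b * R x = x := by
  have hc : star c = c := by
    have h1 : star c * b = 1 := by rw [← hb, ← star_mul, hbc, star_one]
    calc star c = star c * (b * c) := by rw [hbc, mul_one]
      _ = c := by rw [← mul_assoc, h1, one_mul]
  let G : A → A := fun s => b + (2:ℝ) • s + s * c * s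
  have hG : ContDiff ℝ (⊤ : ℕ∞) G := by
    have h2 : ContDiff ℝ (⊤ : ℕ∞) (fun s : A => s * c * s) :=
      (contDiff_id.mul contDiff_const).mul contDiff_id
    exact (contDiff_const.add (contDiff_id.const_smul (2:ℝ))).add h2
  let e : A ≃L[ℝ] A := ContinuousLinearEquiv.smulLeft (Units.mk0 (2:ℝ) two_ne_zero)
  have he : HasFDerivAt G (e : A →L[ℝ] A) 0 := by
    have h1 : HasFDerivAt (fun s : A => s * c * s) (0 : A →L[ℝ] A) 0 := by
      have := ((hasFDerivAt_id (𝕜 := ℝ) (0 : A)).mul' (hasFDerivAt_const c (0:A))).mul'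
        (hasFDerivAt_id (𝕜 := ℝ) (0 : A))
      refine this.congr_fderiv ?_
      ext x
      simp
    have := (((hasFDerivAt_id (𝕜 := ℝ) (0 : A)).const_smul (2:ℝ)).const_add b).add h1
    refine this.congr_fderiv ?_
    ext x
    simp [e, Units.smul_def]
  obtain ⟨P, hPG, h0, -, hPs⟩ := morse_aux_inverse G univ isOpen_univ 0 (mem_univ _)
    hG.contDiffOn e he
  have hG0 : P 0 = b := by rw [hPG]; simp [G]
  have hbt : b ∈ P.target := hG0 ▸ P.map_source h0
  have hsb : P.symm b = 0 := by rw [← hG0, P.left_inv h0]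
  have hstar : ∀ s, G (star s) = star (G s) := by
    intro s
    simp only [G, two_smul, star_add, star_mul, hb, hc, mul_assoc]
  refine ⟨P.target ∩ (fun x => star (P.symm x)) ⁻¹' P.source, fun x => 1 + c * P.symm x,
    ?_, ?_, ?_, ?_, ?_⟩
  · exact (P.symm.continuousOn.star).isOpen_inter_preimage P.open_target P.open_source
  · exact ⟨hbt, by simpa [hsb] using h0⟩
  · exact contDiffOn_const.add (contDiffOn_const.mul (hPs.mono inter_subset_left))
  · simp [hsb]
  · rintro x ⟨hx1, hx2⟩ hx
    have hGx : G (P.symm x) = x := by rw [← hPG, P.right_inv hx1]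
    have hsx : star (P.symm x) = P.symm x := by
      refine P.injOn hx2 (P.map_target hx1) ?_
      rw [hPG, hPG, hstar, hGx, hx]
    set s := P.symm x
    rw [star_add, star_mul, hc, hsx, star_one]
    calc (1 + s * c) * b * (1 + c * s) 
        = b + (b * c) * s + s * (c * b) + s * (c * b) * c * s := by noncomm_ring
      _ = G s := by rw [hbc, hcb]; simp only [G, two_smul]; noncomm_ring
      _ = x := hGx

theorem morse_aux_taylor {E : Type} [NormedAddCommGroup E] [InnerProductSpace ℝ E]
    [FiniteDimensional ℝ E] (V : E → ℝ) (hV : ContDiff ℝ (⊤ : ℕ∞) V) (q : E)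
    (hq : gradient V q = 0) :
    ∃ B : E → (E →L[ℝ] E), ContDiff ℝ (⊤ : ℕ∞) B ∧
      B 0 = (1 / 2 : ℝ) • fderiv ℝ (gradient V) q ∧
      ∀ h, V (q + h) = V q + inner ℝ (B h h) h := by
  have hg : ContDiff ℝ (⊤ : ℕ∞) (gradient V) :=
    (InnerProductSpace.toDual ℝ E).symm.contDiff.comp
      (hV.fderiv_right (m := (⊤ : ℕ∞)) (by simp))
  have hH : ContDiff ℝ (⊤ : ℕ∞) (fderiv ℝ (gradient V)) := hg.fderiv_right (by simp)
  let f : E × ℝ → (E →L[ℝ] E) := fun p => (1 - p.2) • fderiv ℝ (gradient V) (q + p.2 • p.1)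
  have hf : ContDiff ℝ (⊤ : ℕ∞) f := by
    have h1 : ContDiff ℝ (⊤ : ℕ∞) (fun p : E × ℝ => q + p.2 • p.1) := by fun_prop
    exact (contDiff_const.sub contDiff_snd).smul (hH.comp h1)
  refine ⟨fun h => ∫ t in (0:ℝ)..1, f (h, t), morse_aux_contDiff_integral f hf, ?_, ?_⟩
  · simp only [f, smul_zero, add_zero, intervalIntegral.integral_smul_const]
    congr 1
    rw [intervalIntegral.integral_sub (by simp) (by simp)]
    simp
    norm_num
  · intro h
    have hfc : Continuous fun t : ℝ => f (h, t) :=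
      hf.continuous.comp (by fun_prop : Continuous fun t : ℝ => (h, t))
    have e1 : inner ℝ ((∫ t in (0:ℝ)..1, f (h, t)) h) h
        = ∫ t in (0:ℝ)..1, inner ℝ (f (h, t) h) h := by
      let Λ : (E →L[ℝ] E) →L[ℝ] ℝ := (innerSL ℝ h).comp (ContinuousLinearMap.apply ℝ E h)
      have := Λ.intervalIntegral_comp_comm (hfc.intervalIntegrable (μ := MeasureTheory.volume) 0 1)
      simp only [Λ, ContinuousLinearMap.comp_apply, ContinuousLinearMap.apply_apply,
        innerSL_apply_apply] at this
      rw [real_inner_comm, ← this]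
      exact intervalIntegral.integral_congr fun t _ => real_inner_comm _ _
    have hder : ∀ t : ℝ, HasDerivAt (fun t : ℝ => (1 - t) * inner ℝ (gradient V (q + t • h)) h
        + V (q + t • h)) (inner ℝ (f (h, t) h) h) t := by
      intro t
      have hl : HasDerivAt (fun t : ℝ => q + t • h) h t := by
        simpa using ((hasDerivAt_id t).smul_const h).const_add q
      have h1 : HasDerivAt (fun t : ℝ => V (q + t • h)) (inner ℝ (gradient V (q + t • h)) h) t := by
        have hd : HasFDerivAt V (fderiv ℝ V (q + t • h)) (q + t • h) :=
          (hV.differentiable (by simp)).differentiableAt.hasFDerivAt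
        have := hd.comp_hasDerivAt t hl
        refine this.congr_deriv ?_
        simp [gradient]
      have h2 : HasDerivAt (fun t : ℝ => gradient V (q + t • h))
          (fderiv ℝ (gradient V) (q + t • h) h) t :=
        (hg.differentiable (by simp)).differentiableAt.hasFDerivAt.comp_hasDerivAt t hl
      have h3 := h2.inner ℝ (hasDerivAt_const t h)
      have h4 := (((hasDerivAt_id t).const_sub 1).mul h3).add h1
      refine h4.congr_deriv ?_
      simp [f, inner_smul_left]
    have hint : Continuous fun t : ℝ => (inner ℝ (f (h, t) h) h : ℝ) :=
      (hfc.clm_apply continuous_const).inner continuous_const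
    rw [e1, intervalIntegral.integral_eq_sub_of_hasDerivAt (fun t _ => hder t)
      (hint.intervalIntegrable _ _)]
    simp [hq]

theorem morse_aux_perm (N : ℕ) (μ : Fin N → ℝ) (k : ℕ) (hkN : k ≤ N)
    (hk : k = (Finset.univ.filter (fun i : Fin N => μ i < 0)).card) :
    ∃ σ : Equiv.Perm (Fin N), ∀ i, ((σ i : Fin N) : ℕ) < k ↔ μ i < 0 := by
  have hcard : Fintype.card {i : Fin N // μ i < 0} = Fintype.card {l : Fin N // (l : ℕ) < k} := by
    rw [Fintype.card_subtype, ← hk, Fintype.card_subtype, Fin.card_filter_val_lt, min_eq_right hkN]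
  let e := Fintype.equivOfCardEq hcard
  refine ⟨e.extendSubtype, fun i => ⟨fun h => ?_, fun h => e.extendSubtype_mem i h⟩⟩
  by_contra hi
  exact e.extendSubtype_not_mem i hi h

theorem morse_aux_diag (N : ℕ) (basis : OrthonormalBasis (Fin N) ℝ (EuclideanSpace ℝ (Fin N)))
    (a : Fin N → ℝ) (ha : ∀ i, a i ≠ 0) (σ : Equiv.Perm (Fin N)) :
    ∃ L : EuclideanSpace ℝ (Fin N) ≃L[ℝ] EuclideanSpace ℝ (Fin N),
      ∀ y i, L y (σ i) = a i * inner ℝ (basis i) y := by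
  let l : EuclideanSpace ℝ (Fin N) →ₗ[ℝ] EuclideanSpace ℝ (Fin N) :=
    { toFun := fun y => WithLp.toLp 2 fun j => a (σ.symm j) * inner ℝ (basis (σ.symm j)) y
      map_add' := fun x y => by ext j; simp [inner_add_right, mul_add]
      map_smul' := fun r x => by ext j; simp [inner_smul_right]; ring }
  have hl : ∀ y i, l y (σ i) = a i * inner ℝ (basis i) y := fun y i => by simp [l]
  have hinj : Function.Injective l := by
    refine (injective_iff_map_eq_zero l).2 fun y hy => ?_
    refine InnerProductSpace.ext_inner_left_basis basis.toBasis fun i => ?_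
    have := hl y i
    rw [hy] at this
    simpa [ha i] using this
  exact ⟨(LinearEquiv.ofInjectiveEndo l hinj).toContinuousLinearEquiv, fun y i => hl y i⟩



/-- Existence of the Morse chart: near a nondegenerate critical point of Morse index `k`,
the potential takes the universal quadratic normal form
`V(q_c) − Σ_{l<k} x_l² + Σ_{l≥k} x_l²`. -/
theorem morse_chart
    (N : ℕ) (hN : 1 ≤ N) (V : EuclideanSpace ℝ (Fin N) → ℝ)
    (hV : ContDiff ℝ (⊤ : ℕ∞) V) (qc : EuclideanSpace ℝ (Fin N))
    (hcrit : gradient V qc = 0)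
    (hnondeg : ∃ e : EuclideanSpace ℝ (Fin N) ≃L[ℝ] EuclideanSpace ℝ (Fin N),
      (e : EuclideanSpace ℝ (Fin N) →L[ℝ] EuclideanSpace ℝ (Fin N)) =
        fderiv ℝ (gradient V) qc)
    -- the Hessian of `V` at `qc` has an orthonormal basis of eigenvectors with
    -- eigenvalues `μ i`, and `k` is the number of negative eigenvalues (the Morse index)
    (μ : Fin N → ℝ) (basis : OrthonormalBasis (Fin N) ℝ (EuclideanSpace ℝ (Fin N)))
    (heig : ∀ i : Fin N, fderiv ℝ (gradient V) qc (basis i) = μ i • basis i)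
    (k : ℕ) (hkN : k ≤ N)
    (hk : k = (Finset.univ.filter (fun i : Fin N => μ i < 0)).card) :
    ∃ (U W : Set (EuclideanSpace ℝ (Fin N)))
      (φ ψ : EuclideanSpace ℝ (Fin N) → EuclideanSpace ℝ (Fin N)),
      IsOpen U ∧ IsOpen W ∧ (0 : EuclideanSpace ℝ (Fin N)) ∈ U ∧ qc ∈ W ∧
      φ 0 = qc ∧ Set.BijOn φ U W ∧
      ContDiffOn ℝ (⊤ : ℕ∞) φ U ∧ ContDiffOn ℝ (⊤ : ℕ∞) ψ W ∧
      (∀ x ∈ U, ψ (φ x) = x) ∧ (∀ y ∈ W, φ (ψ y) = y) ∧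
      (∀ x ∈ U, V (φ x) = V qc
        - (∑ l ∈ Finset.univ.filter (fun l : Fin N => (l : ℕ) < k), x l ^ 2)
        + ∑ l ∈ Finset.univ.filter (fun l : Fin N => k ≤ (l : ℕ)), x l ^ 2) := by
  obtain ⟨B, hB, hB0, hVB⟩ := morse_aux_taylor V hV qc hcrit
  obtain ⟨e, he⟩ := hnondeg
  set H := fderiv ℝ (gradient V) qc with hHdef
  -- the quadratic form of the Hessian in the eigenbasis
  have hHin : ∀ x y, inner ℝ (H x) y = ∑ i, μ i * inner ℝ (basis i) x * inner ℝ (basis i) y := by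
    intro x y
    conv_lhs => rw [← basis.sum_repr' x]
    simp only [map_sum, map_smul, heig, sum_inner, inner_smul_left]
    refine Finset.sum_congr rfl fun i _ => ?_
    simp only [conj_trivial]
    ring
  have hHs : star H = H := by
    refine (ContinuousLinearMap.isSelfAdjoint_iff_isSymmetric.2 fun x y => ?_)
    change inner ℝ (H x) y = inner ℝ x (H y)
    rw [real_inner_comm (H y) x, hHin, hHin]
    exact Finset.sum_congr rfl fun i _ => by ring
  have hμ : ∀ i, μ i ≠ 0 := by
    intro i hi
    have h1 := heig i
    rw [hi, zero_smul, ← he] at h1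
    have h2 : basis i = 0 := e.map_eq_zero_iff.1 h1
    have h3 := basis.orthonormal.1 i
    rw [h2] at h3
    simp at h3
  -- symmetrized Taylor coefficient
  let B' : EuclideanSpace ℝ (Fin N) →
      (EuclideanSpace ℝ (Fin N) →L[ℝ] EuclideanSpace ℝ (Fin N)) :=
    fun h => (1 / 2 : ℝ) • (B h + star (B h))
  have hB' : ContDiff ℝ (⊤ : ℕ∞) B' := by
    have h1 : ContDiff ℝ (⊤ : ℕ∞) (fun h => star (B h)) :=
      (starL' ℝ (A := EuclideanSpace ℝ (Fin N) →L[ℝ] EuclideanSpace ℝ (Fin N))).contDiff.comp hB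
    exact (hB.add h1).const_smul _
  have hB's : ∀ h, star (B' h) = B' h := by
    intro h
    have h1 : star (B h + star (B h)) = B h + star (B h) := by
      have h2 := star_add (B h) (star (B h))
      rw [star_star] at h2
      exact h2.trans (add_comm _ _)
    simp only [B', star_smul, h1, star_trivial]
  have hB'0 : B' 0 = (1 / 2 : ℝ) • H := by
    simp only [B', hB0, star_smul, hHs, star_trivial]
    rw [← two_smul ℝ, smul_smul, smul_smul]
    norm_num
  have hVB' : ∀ h, V (qc + h) = V qc + inner ℝ (B' h h) h := by
    intro h
    rw [hVB h]
    have h1 : inner ℝ ((star (B h)) h) h = inner ℝ (B h h) h := by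
      rw [ContinuousLinearMap.star_eq_adjoint, ContinuousLinearMap.adjoint_inner_left,
        real_inner_comm]
    simp only [B', smul_apply, add_apply, inner_smul_left,
      inner_add_left, h1, conj_trivial]
    ring
  let c : EuclideanSpace ℝ (Fin N) →L[ℝ] EuclideanSpace ℝ (Fin N) := (2 : ℝ) • (e.symm :
    EuclideanSpace ℝ (Fin N) →L[ℝ] EuclideanSpace ℝ (Fin N))
  obtain ⟨T, R, hTo, hbT, hR, hRb, hRx⟩ := morse_aux_sqrt (B' 0) c
    (by rw [hB'0, ← he]; ext x; simp [c])
    (by rw [hB'0, ← he]; ext x; simp [c]) (hB's 0)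
  obtain ⟨σ, hσ⟩ := morse_aux_perm N μ k hkN hk
  have hpos : ∀ i, 0 < |μ i| / 2 := fun i => by have := abs_pos.2 (hμ i); positivity
  obtain ⟨L, hL⟩ := morse_aux_diag N basis (fun i => √(|μ i| / 2))
    (fun i => (Real.sqrt_pos.2 (hpos i)).ne') σ
  let O : Set (EuclideanSpace ℝ (Fin N)) := (fun q => B' (q - qc)) ⁻¹' T
  have hBs : ContDiff ℝ (⊤ : ℕ∞) (fun q => B' (q - qc)) :=
    hB'.comp (contDiff_id.sub contDiff_const)
  have hO : IsOpen O := hTo.preimage hBs.continuous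
  have hqO : qc ∈ O := by simpa [O] using hbT
  have hRO : ContDiffOn ℝ (⊤ : ℕ∞) (fun q => R (B' (q - qc))) O :=
    hR.comp hBs.contDiffOn (fun q hq => hq)
  let f : EuclideanSpace ℝ (Fin N) → EuclideanSpace ℝ (Fin N) :=
    fun q => L (R (B' (q - qc)) (q - qc))
  have hf : ContDiffOn ℝ (⊤ : ℕ∞) f O :=
    L.contDiff.comp_contDiffOn (hRO.clm_apply (contDiff_id.sub contDiff_const).contDiffOn)
  have hfd : HasFDerivAt f (L : EuclideanSpace ℝ (Fin N) →L[ℝ] EuclideanSpace ℝ (Fin N)) qc := by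
    have h1 : HasFDerivAt (fun q => R (B' (q - qc))) _ qc :=
      ((hRO.contDiffAt (hO.mem_nhds hqO)).differentiableAt (by simp)).hasFDerivAt
    have h2 := h1.clm_apply ((hasFDerivAt_id (𝕜 := ℝ) qc).sub_const qc)
    have h3 := (L.hasFDerivAt (x := R (B' (qc - qc)) (qc - qc))).comp qc h2
    refine h3.congr_fderiv ?_
    ext x
    simp [hRb]
  obtain ⟨P, hPf, hqP, hPO, hPs⟩ := morse_aux_inverse f O hO qc hqO hf L hfd
  have hP0 : P qc = 0 := by rw [hPf]; simp [f]
  refine ⟨P.target, P.source, P.symm, P, P.open_target, P.open_source, hP0 ▸ P.map_source hqP,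
    hqP, by rw [← hP0, P.left_inv hqP], P.symm.bijOn, hPs,
    (hf.mono hPO).congr fun x _ => hPf x, fun x hx => P.right_inv hx,
    fun y hy => P.left_inv hy, ?_⟩
  intro x hx
  have hqs : P.symm x ∈ P.source := P.map_target hx
  have hfx : f (P.symm x) = x := by rw [← hPf, P.right_inv hx]
  obtain ⟨h, hh⟩ : ∃ h, h = P.symm x - qc := ⟨_, rfl⟩
  have hT : B' h ∈ T := by rw [hh]; exact hPO hqs
  have hq : P.symm x = qc + h := by rw [hh]; abel
  obtain ⟨y, hy⟩ : ∃ y, y = R (B' h) h := ⟨_, rfl⟩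
  have hxy : x = L y := by rw [← hfx, hy, hh]
  have hquad : inner ℝ (B' h h) h = ∑ i, (1 / 2) * (μ i * inner ℝ (basis i) y ^ 2) := by
    have h1 : inner ℝ (B' h h) h = inner ℝ (B' 0 y) y := by
      conv_lhs => rw [← hRx _ hT (hB's h)]
      rw [mul_apply_eq_comp, mul_apply_eq_comp,
        ContinuousLinearMap.star_eq_adjoint, ContinuousLinearMap.adjoint_inner_left, ← hy]
    rw [h1, hB'0, smul_apply, inner_smul_left, hHin, Finset.mul_sum]
    refine Finset.sum_congr rfl fun i _ => ?_
    simp only [conj_trivial]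
    ring
  rw [hq, hVB', hquad]
  have hsum : ∑ i, (1 / 2) * (μ i * inner ℝ (basis i) y ^ 2)
      = ∑ l : Fin N, ((if k ≤ (l : ℕ) then x l ^ 2 else 0) - (if (l : ℕ) < k then x l ^ 2 else 0)) := by
    rw [← Equiv.sum_comp σ (fun l : Fin N =>
      ((if k ≤ (l : ℕ) then x l ^ 2 else 0) - (if (l : ℕ) < k then x l ^ 2 else 0)))]
    refine Finset.sum_congr rfl fun i _ => ?_
    have hsq : x (σ i) ^ 2 = |μ i| / 2 * inner ℝ (basis i) y ^ 2 := by
      rw [hxy, hL, mul_pow, Real.sq_sqrt (hpos i).le]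
    rw [hsq]
    by_cases hi : μ i < 0
    · have h1 := (hσ i).2 hi
      rw [if_pos h1, if_neg (not_le.2 h1), abs_of_neg hi]
      ring
    · have h1 := mt (hσ i).1 hi
      rw [if_neg h1, if_pos (not_lt.1 h1), abs_of_nonneg (not_lt.1 hi)]
      ring
  rw [hsum, Finset.sum_sub_distrib, Finset.sum_filter, Finset.sum_filter]
  ring
end
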